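/- arXiv:1305.0832 — 11 statements merged into one kernel-verified Lean document; each statement's English description precedes it below -/
import Mathlib

section
/- Let (X,d,≤) be a quasi-ordered metric space which is complete (every ascending Cauchy sequence converges), let T : X → X be ≤-increasing with {x ∈ X : x ≤ Tx} nonempty, and suppose that either T is ≤-continuous or the relation ≤ is self-closed. Assume there is a Matkowski function φ (i.e. φ : [0,∞) → [0,∞) increasing, with φ(0) = 0, φ(t) < t for all t > 0, and φ^n(t) → 0 for every t > 0) such that d(Tx,Ty) ≤ φ(d(x,y)) for all x,y ∈ X with x ≤ y. Then T is a global Picard operator modulo (d,≤): for every x ∈ X with x ≤ Tx the sequence (T^n x) converges to a fixed point of T, and any two fixed points z, w of T with z ≤ w are equal. -/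
open Filter Topology
open scoped NNReal

/-- **Theorem 1 (Turinici 1986).**
Let `(X, d, le)` be a quasi-ordered metric space that is complete (every ascending Cauchy
sequence converges), `T` a `le`-increasing selfmap with `{x : le x (T x)}` nonempty, and
assume either `T` is `le`-continuous or `le` is self-closed.  If `φ` is a Matkowski function
(increasing, `φ 0 = 0`, `φ t < t` for `t > 0`, `φ^[n] t → 0` for all `t > 0`) and
`d (T x) (T y) ≤ φ (d x y)` whenever `le x y`, then `T` is a global Picard operator:
for each `x` with `le x (T x)` the sequence `T^[n] x` converges to a fixed point of `T`,
and any two comparable fixed points coincide. -/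
theorem global_picard_of_matkowski_contraction
    {X : Type*} [MetricSpace X]
    (le : X → X → Prop)
    (hrefl : ∀ x, le x x)
    (htrans : ∀ x y z, le x y → le y z → le x z)
    (hcomplete : ∀ x : ℕ → X, (∀ n, le (x n) (x (n + 1))) → CauchySeq x →
      ∃ a, Tendsto x atTop (nhds a))
    (T : X → X)
    (hmono : ∀ x y, le x y → le (T x) (T y))
    (hne : ∃ x, le x (T x))
    (hreg :
      (∀ (x : ℕ → X) (a : X), (∀ n, le (x n) (x (n + 1))) →
        Tendsto x atTop (nhds a) →
        Tendsto (fun n => T (x n)) atTop (nhds (T a)))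
      ∨
      (∀ (x : ℕ → X) (a : X), (∀ n, le (x n) (x (n + 1))) →
        Tendsto x atTop (nhds a) → ∀ n, le (x n) a))
    (φ : ℝ≥0 → ℝ≥0)
    (hφ_mono : Monotone φ)
    (hφ_zero : φ 0 = 0)
    (hφ_lt : ∀ t : ℝ≥0, 0 < t → φ t < t)
    (hφ_iter : ∀ t : ℝ≥0, 0 < t → Tendsto (fun n => φ^[n] t) atTop (nhds 0))
    (hcontr : ∀ x y, le x y → nndist (T x) (T y) ≤ φ (nndist x y)) :
    (∀ x, le x (T x) →
      ∃ z, Tendsto (fun n => T^[n] x) atTop (nhds z) ∧ T z = z) ∧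
    (∀ z w, T z = z → T w = w → le z w → z = w) := by
  have hle : ∀ t, φ t ≤ t := by
    intro t
    rcases eq_or_lt_of_le (zero_le (a := t)) with h | h
    · rw [← h, hφ_zero]
    · exact (hφ_lt t h).le
  have hit : ∀ t, Tendsto (fun n => φ^[n] t) atTop (nhds 0) := by
    intro t
    rcases eq_or_lt_of_le (zero_le (a := t)) with h | h
    · have : (fun n => φ^[n] t) = fun _ => 0 := by
        funext n
        rw [← h]
        exact Function.iterate_fixed hφ_zero n
      rw [this]
      exact tendsto_const_nhds
    · exact hφ_iter t h
  refine ⟨?_, ?_⟩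
  · intro x hx
    have hs : ∀ n, T^[n + 1] x = T (T^[n] x) := fun n => Function.iterate_succ_apply' T n x
    have hasc : ∀ n, le (T^[n] x) (T^[n + 1] x) := by
      intro n
      induction n with
      | zero => exact hx
      | succ k ih =>
        rw [hs (k + 1), hs k]
        rw [hs k] at ih
        exact hmono _ _ ih
    have hascK : ∀ n k, le (T^[n] x) (T^[n + k] x) := by
      intro n k
      induction k with
      | zero => exact hrefl _
      | succ k ih => exact htrans _ _ _ ih (hasc (n + k))
    have hd : ∀ n, nndist (T^[n] x) (T^[n + 1] x) ≤ φ^[n] (nndist x (T x)) := by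
      intro n
      induction n with
      | zero => exact le_rfl
      | succ k ih =>
        rw [Function.iterate_succ_apply' φ, hs (k + 1)]
        nth_rewrite 1 [hs k]
        exact (hcontr _ _ (hasc k)).trans (hφ_mono ih)
    have hC : CauchySeq (fun n => T^[n] x) := by
      rw [Metric.cauchySeq_iff']
      intro ε' hε'
      obtain ⟨ε, hε, hεε⟩ : ∃ ε : ℝ≥0, 0 < ε ∧ (ε : ℝ) < ε' :=
        ⟨(ε' / 2).toNNReal, Real.toNNReal_pos.2 (half_pos hε'), by
          rw [Real.coe_toNNReal _ (half_pos hε').le]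
          exact half_lt_self hε'⟩
      have hpos : 0 < ε - φ ε := tsub_pos_of_lt (hφ_lt ε hε)
      obtain ⟨N, hN⟩ := ((hit (nndist x (T x))).eventually (gt_mem_nhds hpos)).exists
      have key : ∀ k, nndist (T^[N] x) (T^[N + k] x) ≤ ε := by
        intro k
        induction k with
        | zero => simp
        | succ k ih =>
          calc nndist (T^[N] x) (T^[N + (k + 1)] x)
              ≤ nndist (T^[N] x) (T^[N + 1] x)
                + nndist (T^[N + 1] x) (T^[N + (k + 1)] x) := nndist_triangle _ _ _
            _ ≤ (ε - φ ε) + φ ε := by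
                refine add_le_add ((hd N).trans hN.le) ?_
                rw [hs N, ← add_assoc, hs (N + k)]
                exact (hcontr _ _ (hascK N k)).trans (hφ_mono ih)
            _ = ε := tsub_add_cancel_of_le (hle ε)
      refine ⟨N, fun n hn => ?_⟩
      obtain ⟨k, rfl⟩ := Nat.exists_eq_add_of_le hn
      rw [dist_comm]
      refine lt_of_le_of_lt ?_ hεε
      have := key k
      rw [← NNReal.coe_le_coe, coe_nndist] at this
      exact this
    obtain ⟨a, ha⟩ := hcomplete _ hasc hC
    refine ⟨a, ha, ?_⟩
    have h1 : Tendsto (fun n => T (T^[n] x)) atTop (nhds a) := by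
      have := (tendsto_add_atTop_iff_nat 1).2 ha
      simpa only [hs] using this
    rcases hreg with hc | hc
    · exact tendsto_nhds_unique (hc _ a hasc ha) h1
    · refine tendsto_nhds_unique ?_ h1
      have hub := hc _ a hasc ha
      rw [tendsto_iff_dist_tendsto_zero] at ha ⊢
      refine squeeze_zero (fun _ => dist_nonneg) (fun n => ?_) ha
      have := (hcontr _ _ (hub n)).trans (hle _)
      rw [← NNReal.coe_le_coe, coe_nndist, coe_nndist] at this
      exact this
  · intro z w hz hw hzw
    by_contra hne'
    have h := hcontr z w hzw
    rw [hz, hw] at h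
    exact absurd (hφ_lt _ (pos_iff_ne_zero.2 (fun h0 => hne' (nndist_eq_zero.1 h0)))) (not_lt.2 h)
end

section
/- Let (X,d) be a metric space and (x_n; n ≥ 0) a sequence in X such that d(x_n,x_{n+1}) > 0 for all n, d(x_n,x_{n+1}) → 0, and (x_n) is not a Cauchy sequence. Let Θ ⊆ (0,∞) be (>)-cofinal in (0,∞) (for each ε > 0 there exists θ ∈ Θ with θ < ε). Then there exist a number b ∈ Θ, a rank j(b) ≥ 0, and sequences of natural numbers (m(j)), (n(j)) such that: (i) j ≤ m(j) < n(j) and d(x_{m(j)}, x_{n(j)}) > b for all j ≥ 0; (ii) n(j) − m(j) ≥ 2 and d(x_{m(j)}, x_{n(j)−1}) ≤ b for all j ≥ j(b); (iii) d(x_{m(j)}, x_{n(j)}) > b for all j and d(x_{m(j)}, x_{n(j)}) → b as j → ∞; (iv) for every p,q ∈ {0,1}, d(x_{m(j)+p}, x_{n(j)+q}) > 0 for all j ≥ j(b) and d(x_{m(j)+p}, x_{n(j)+q}) → b as j → ∞. -/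
open Filter Topology

/-- **Proposition 2.1.**
If `(x n)` is a sequence in a metric space with `dist (x n) (x (n+1)) > 0` for all `n`,
`dist (x n) (x (n+1)) → 0` (semi-Cauchy), which is not Cauchy, and `Θ ⊆ (0,∞)` is
`(>)`-cofinal in `(0,∞)`, then there exist `b ∈ Θ`, a rank `jb`, and rank sequences
`m, n` such that:
(i) `j ≤ m j < n j` and `dist (x (m j)) (x (n j)) > b` for all `j`;
(ii) `n j - m j ≥ 2` and `dist (x (m j)) (x (n j - 1)) ≤ b` for `j ≥ jb`;
(iii) `dist (x (m j)) (x (n j)) → b`;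
(iv) for all `p, q ∈ {0,1}`, `dist (x (m j + p)) (x (n j + q)) > 0`
for `j ≥ jb` and `dist (x (m j + p)) (x (n j + q)) → b`. -/
theorem semiCauchy_not_cauchy_rank_sequences
    {X : Type*} [MetricSpace X] (x : ℕ → X)
    (hpos : ∀ n, 0 < dist (x n) (x (n + 1)))
    (hsemi : Tendsto (fun n => dist (x n) (x (n + 1))) atTop (nhds 0))
    (hnotCauchy : ¬ CauchySeq x)
    (Θ : Set ℝ) (hΘ : Θ ⊆ Set.Ioi 0)
    (hcof : ∀ ε : ℝ, 0 < ε → ∃ θ ∈ Θ, θ < ε) :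
    ∃ b ∈ Θ, ∃ jb : ℕ, ∃ m n : ℕ → ℕ,
      (∀ j, j ≤ m j ∧ m j < n j ∧ b < dist (x (m j)) (x (n j))) ∧
      (∀ j, jb ≤ j → 2 ≤ n j - m j ∧ dist (x (m j)) (x (n j - 1)) ≤ b) ∧
      Tendsto (fun j => dist (x (m j)) (x (n j))) atTop (nhds b) ∧
      (∀ p q : ℕ, p ≤ 1 → q ≤ 1 →
        (∀ j, jb ≤ j → 0 < dist (x (m j + p)) (x (n j + q))) ∧
        Tendsto (fun j => dist (x (m j + p)) (x (n j + q))) atTop (nhds b)) := by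
  classical
  rw [Metric.cauchySeq_iff] at hnotCauchy
  push Not at hnotCauchy
  obtain ⟨ε, hε, hN⟩ := hnotCauchy
  obtain ⟨b, hbΘ, hbε⟩ := hcof ε hε
  have hb : 0 < b := hΘ hbΘ
  have h1 : ∀ j, ∃ m n, j ≤ m ∧ m < n ∧ b < dist (x m) (x n) := by
    intro j
    obtain ⟨m, hm, n, hn, hd⟩ := hN j
    rcases lt_trichotomy m n with h | h | h
    · exact ⟨m, n, hm, h, by linarith⟩
    · subst h
      rw [dist_self] at hd
      linarith
    · exact ⟨n, m, hn, h, by rw [dist_comm]; linarith⟩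
  have h2 : ∀ j, ∃ m n, j ≤ m ∧ m < n ∧ b < dist (x m) (x n) ∧
      dist (x m) (x (n - 1)) ≤ b := by
    intro j
    obtain ⟨m, n, hm, hn, hd⟩ := h1 j
    have hex : ∃ n, m < n ∧ b < dist (x m) (x n) := ⟨n, hn, hd⟩
    obtain ⟨ha, hc⟩ := Nat.find_spec hex
    refine ⟨m, Nat.find hex, hm, ha, hc, ?_⟩
    by_contra hlt
    rw [not_le] at hlt
    by_cases hk : m < Nat.find hex - 1
    · exact Nat.find_min hex (by omega) ⟨hk, hlt⟩
    · have he : Nat.find hex - 1 = m := by omega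
      rw [he, dist_self] at hlt
      linarith
  choose m n hm hmn hd hd' using h2
  have hr : ∀ δ > 0, ∃ N, ∀ k ≥ N, dist (x k) (x (k + 1)) < δ := by
    intro δ hδ
    exact eventually_atTop.1 (hsemi.eventually_lt_const hδ)
  have hup : ∀ j, dist (x (m j)) (x (n j)) ≤ b + dist (x (n j - 1)) (x (n j - 1 + 1)) := by
    intro j
    have h := dist_triangle (x (m j)) (x (n j - 1)) (x (n j))
    have e : n j - 1 + 1 = n j := by have := hmn j; omega
    rw [e]
    linarith [hd' j]
  have hstep : ∀ k p, p ≤ 1 → dist (x k) (x (k + p)) ≤ dist (x k) (x (k + 1)) := by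
    intro k p hp
    interval_cases p
    · simp
    · exact le_rfl
  have key : ∀ δ > 0, ∃ N, ∀ j ≥ N, ∀ p q, p ≤ 1 → q ≤ 1 →
      |dist (x (m j + p)) (x (n j + q)) - b| < δ := by
    intro δ hδ
    obtain ⟨N, hN⟩ := hr (δ / 4) (by linarith)
    refine ⟨N, fun j hj p q hp hq => ?_⟩
    have a1 := hm j
    have a2 := hmn j
    have b1 := hN (m j) (by omega)
    have b2 := hN (n j) (by omega)
    have b3 := hN (n j - 1) (by omega)
    have c1 := hstep (m j) p hp
    have c2 := hstep (n j) q hq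
    have d1 := dist_triangle4 (x (m j)) (x (m j + p)) (x (n j + q)) (x (n j))
    have d2 := dist_triangle4 (x (m j + p)) (x (m j)) (x (n j)) (x (n j + q))
    rw [dist_comm (x (n j + q)) (x (n j))] at d1
    rw [dist_comm (x (m j + p)) (x (m j))] at d2
    have := hup j
    have := hd j
    rw [abs_lt]
    constructor <;> linarith
  have hlim : ∀ p q, p ≤ 1 → q ≤ 1 →
      Tendsto (fun j => dist (x (m j + p)) (x (n j + q))) atTop (nhds b) := by
    intro p q hp hq
    rw [Metric.tendsto_atTop]
    intro δ hδ
    obtain ⟨N, hN⟩ := key δ hδ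
    exact ⟨N, fun j hj => by rw [Real.dist_eq]; exact hN j hj p q hp hq⟩
  obtain ⟨N1, hN1⟩ := key b hb
  obtain ⟨N2, hN2⟩ := hr b hb
  refine ⟨b, hbΘ, max N1 N2, m, n, fun j => ⟨hm j, hmn j, hd j⟩, fun j hj => ⟨?_, hd' j⟩,
    hlim 0 0 (by omega) (by omega), fun p q hp hq => ⟨fun j hj => ?_, hlim p q hp hq⟩⟩
  · have a1 := hm j
    have a2 := hmn j
    have a3 : N2 ≤ j := le_trans (le_max_right _ _) hj
    by_contra hlt
    have e : n j = m j + 1 := by omega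
    have h := hd j
    rw [e] at h
    linarith [hN2 (m j) (by omega)]
  · have h := hN1 j (le_trans (le_max_left _ _) hj) p q hp hq
    rw [abs_lt] at h
    linarith [h.1]
end

section
/- Let (X,d,≤) be a quasi-ordered metric space which is complete (every ascending Cauchy sequence converges), let T : X → X be ≤-increasing with {x ∈ X : x ≤ Tx} nonempty, and suppose that either T is ≤-continuous or the relation ≤ is self-closed. Let F : [0,∞)^6 → ℝ be compatible, almost 2-right-lim-positive and 4-point-lim-positive, and assume T is (d,≤;M;F)-contractive, i.e. F(d(Tx,Ty), d(x,y), d(x,Tx), d(y,Ty), d(x,Ty), d(Tx,y)) ≤ 0 for all x,y ∈ X with x ≤ y and x ≠ y. Then T is a Picard operator modulo (d,≤): for every x ∈ X with x ≤ Tx the sequence (T^n x) converges and its limit is a fixed point of T. -/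
open Filter Topology
open scoped NNReal

/-- `F : [0,∞)^6 → ℝ` is compatible: for all sequences `(r n)` in `(0,∞)` and `(s n)` in
`[0,∞)` with `F (r (n+1)) (r n) (r n) (r (n+1)) (s n) 0 ≤ 0` and `|s n - r n| ≤ r (n+1)`
for all `n`, one has `r n → 0`. -/
def FCompatible (F : ℝ≥0 → ℝ≥0 → ℝ≥0 → ℝ≥0 → ℝ≥0 → ℝ≥0 → ℝ) : Prop :=
  ∀ r s : ℕ → ℝ≥0, (∀ n, 0 < r n) →
    (∀ n, F (r (n + 1)) (r n) (r n) (r (n + 1)) (s n) 0 ≤ 0) →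
    (∀ n, |(s n : ℝ) - (r n : ℝ)| ≤ (r (n + 1) : ℝ)) →
    Filter.Tendsto r Filter.atTop (nhds 0)

/-- `F` is 2-right-lim-positive at `b`: for every sequence of points of `(0,∞)^6` whose
components tend respectively to `b`, `b` (from the strict right), `0`, `0`, `b`, `b`,
the `limsup` of the values of `F` is positive. -/
def TwoRightLimPositiveAt (F : ℝ≥0 → ℝ≥0 → ℝ≥0 → ℝ≥0 → ℝ≥0 → ℝ≥0 → ℝ) (b : ℝ≥0) : Prop :=
  ∀ t₁ t₂ t₃ t₄ t₅ t₆ : ℕ → ℝ≥0,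
    (∀ n, 0 < t₁ n) → (∀ n, 0 < t₂ n) → (∀ n, 0 < t₃ n) →
    (∀ n, 0 < t₄ n) → (∀ n, 0 < t₅ n) → (∀ n, 0 < t₆ n) →
    Filter.Tendsto t₁ Filter.atTop (nhds b) →
    Filter.Tendsto t₂ Filter.atTop (nhds b) → (∀ n, b < t₂ n) →
    Filter.Tendsto t₃ Filter.atTop (nhds 0) →
    Filter.Tendsto t₄ Filter.atTop (nhds 0) →
    Filter.Tendsto t₅ Filter.atTop (nhds b) →
    Filter.Tendsto t₆ Filter.atTop (nhds b) →
    0 < Filter.limsup (fun n => F (t₁ n) (t₂ n) (t₃ n) (t₄ n) (t₅ n) (t₆ n)) Filter.atTop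

/-- `F` is almost 2-right-lim-positive: the set of `b > 0` at which `F` is
2-right-lim-positive is `(>)`-cofinal in `(0,∞)`. -/
def AlmostTwoRightLimPositive (F : ℝ≥0 → ℝ≥0 → ℝ≥0 → ℝ≥0 → ℝ≥0 → ℝ≥0 → ℝ) : Prop :=
  ∀ ε : ℝ≥0, 0 < ε → ∃ b : ℝ≥0, 0 < b ∧ b < ε ∧ TwoRightLimPositiveAt F b

/-- `F` is 4-point-lim-positive at `b`: for every sequence of points of `(0,∞)^6` whose
components tend respectively to `b`, `0`, `0`, are constantly `b`, tend to `b`, `0`,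
the `limsup` of the values of `F` is positive. -/
def FourPointLimPositiveAt (F : ℝ≥0 → ℝ≥0 → ℝ≥0 → ℝ≥0 → ℝ≥0 → ℝ≥0 → ℝ) (b : ℝ≥0) : Prop :=
  ∀ t₁ t₂ t₃ t₅ t₆ : ℕ → ℝ≥0,
    (∀ n, 0 < t₁ n) → (∀ n, 0 < t₂ n) → (∀ n, 0 < t₃ n) →
    (∀ n, 0 < t₅ n) → (∀ n, 0 < t₆ n) →
    Filter.Tendsto t₁ Filter.atTop (nhds b) →
    Filter.Tendsto t₂ Filter.atTop (nhds 0) →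
    Filter.Tendsto t₃ Filter.atTop (nhds 0) →
    Filter.Tendsto t₅ Filter.atTop (nhds b) →
    Filter.Tendsto t₆ Filter.atTop (nhds 0) →
    0 < Filter.limsup (fun n => F (t₁ n) (t₂ n) (t₃ n) b (t₅ n) (t₆ n)) Filter.atTop

/-- `F` is 4-point-lim-positive: it is 4-point-lim-positive at every `b > 0`. -/
def FourPointLimPositive (F : ℝ≥0 → ℝ≥0 → ℝ≥0 → ℝ≥0 → ℝ≥0 → ℝ≥0 → ℝ) : Prop :=
  ∀ b : ℝ≥0, 0 < b → FourPointLimPositiveAt F b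

theorem aux_limsup_nonpos (u : ℕ → ℝ) (h : ∀ n, u n ≤ 0) : limsup u atTop ≤ 0 := by
  rw [limsup_eq]
  have h0 : (0 : ℝ) ∈ {a : ℝ | ∀ᶠ n in atTop, u n ≤ a} := Eventually.of_forall h
  by_cases hb : BddBelow {a : ℝ | ∀ᶠ n in atTop, u n ≤ a}
  · exact csInf_le hb h0
  · exact (Real.sInf_of_not_bddBelow hb).le

theorem aux_tendsto (t : ℕ → ℝ≥0) (b : ℝ≥0)
    (h : ∀ k : ℕ, |(t k : ℝ) - b| ≤ 2 * (1 / ((k : ℝ) + 1))) : Tendsto t atTop (nhds b) := by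
  rw [tendsto_iff_dist_tendsto_zero]
  have h1 : Tendsto (fun k : ℕ => 2 * (1 / ((k : ℝ) + 1))) atTop (nhds 0) := by
    simpa using (tendsto_one_div_add_atTop_nhds_zero_nat (𝕜 := ℝ)).const_mul 2
  refine squeeze_zero (fun _ => dist_nonneg) (fun k => ?_) h1
  rw [NNReal.dist_eq]
  exact h k

/-- The core step: an iterate sequence with vanishing steps is Cauchy. -/
theorem aux_cauchy {X : Type*} [MetricSpace X] (le : X → X → Prop) (y : ℕ → X)
    (hle : ∀ m n, m ≤ n → le (y m) (y n))
    (F : ℝ≥0 → ℝ≥0 → ℝ≥0 → ℝ≥0 → ℝ≥0 → ℝ≥0 → ℝ)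
    (hF2 : AlmostTwoRightLimPositive F)
    (hc : ∀ m n, le (y m) (y n) → y m ≠ y n →
      F (nndist (y (m+1)) (y (n+1))) (nndist (y m) (y n)) (nndist (y m) (y (m+1)))
        (nndist (y n) (y (n+1))) (nndist (y m) (y (n+1))) (nndist (y (m+1)) (y n)) ≤ 0)
    (hpos : ∀ n, y n ≠ y (n+1))
    (hr : Tendsto (fun n => dist (y n) (y (n+1))) atTop (nhds 0)) : CauchySeq y := by
  by_contra hC
  rw [Metric.cauchySeq_iff'] at hC
  push Not at hC
  obtain ⟨ε, hε, hC⟩ := hC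
  obtain ⟨b, hb0, hbε, hb⟩ := hF2 ⟨ε, hε.le⟩ (by exact_mod_cast hε)
  have hb0' : (0 : ℝ) < b := by exact_mod_cast hb0
  have hbε' : (b : ℝ) < ε := by exact_mod_cast hbε
  have key : ∀ k : ℕ, ∃ m n : ℕ, m ≤ n ∧ (b : ℝ) < dist (y m) (y n) ∧
      dist (y m) (y n) ≤ b + 1 / ((k : ℝ) + 1) ∧
      dist (y m) (y (m+1)) < b / 3 ∧ dist (y n) (y (n+1)) < b / 3 ∧
      dist (y m) (y (m+1)) < (1 / ((k : ℝ) + 1)) / 2 ∧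
      dist (y n) (y (n+1)) < (1 / ((k : ℝ) + 1)) / 2 := by
    intro k
    have hk : (0 : ℝ) < 1 / ((k : ℝ) + 1) := by positivity
    have e1 := hr.eventually_lt_const (show (0:ℝ) < b / 3 by positivity)
    have e2 := hr.eventually_lt_const (show (0:ℝ) < (1 / ((k : ℝ) + 1)) / 2 by positivity)
    obtain ⟨N, hN⟩ := eventually_atTop.1 (e1.and e2)
    classical
    have hex : ∃ n, N ≤ n ∧ (b : ℝ) < dist (y N) (y n) := by
      obtain ⟨n, hn, h⟩ := hC N
      exact ⟨n, hn, by rw [dist_comm]; linarith⟩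
    obtain ⟨h1, h2⟩ := Nat.find_spec hex
    have hmin := fun j => Nat.find_min (H := hex) (m := j)
    generalize Nat.find hex = n at h1 h2 hmin
    refine ⟨N, n, h1, h2, ?_, (hN N le_rfl).1, (hN n h1).1, (hN N le_rfl).2, (hN n h1).2⟩
    rcases Nat.eq_or_lt_of_le h1 with h | h
    · subst h
      rw [dist_self] at h2
      linarith
    · obtain ⟨j, rfl⟩ : ∃ j, n = j + 1 := ⟨n - 1, by omega⟩
      have hj := hmin j (by omega)
      have hNj : N ≤ j := by omega
      have hj2 : dist (y N) (y j) ≤ b := by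
        by_contra hcon
        exact hj ⟨hNj, not_le.1 hcon⟩
      have := dist_triangle (y N) (y j) (y (j+1))
      have := (hN j hNj).2
      linarith
  choose m n hmn k1 k2 k3 k4 k5 k6 using key
  have pos : ∀ u v, 0 < dist (y u) (y v) → 0 < nndist (y u) (y v) := by
    intro u v h
    exact_mod_cast h
  have hd : ∀ k, |dist (y (m k + 1)) (y (n k + 1)) - dist (y (m k)) (y (n k))| ≤
        dist (y (m k)) (y (m k + 1)) + dist (y (n k)) (y (n k + 1)) ∧
      |dist (y (m k)) (y (n k + 1)) - dist (y (m k)) (y (n k))| ≤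
        dist (y (n k)) (y (n k + 1)) ∧
      |dist (y (m k + 1)) (y (n k)) - dist (y (m k)) (y (n k))| ≤
        dist (y (m k)) (y (m k + 1)) := by
    intro k
    have q : ∀ a a' c c' : X, |dist a' c' - dist a c| ≤ dist a a' + dist c c' := by
      intro a a' c c'
      have := dist_triangle4 a a' c' c
      have := dist_triangle4 a' a c c'
      rw [dist_comm c' c] at *
      rw [dist_comm a' a] at *
      rw [abs_le]
      constructor <;> linarith
    refine ⟨q _ _ _ _, ?_, ?_⟩
    · simpa using q (y (m k)) (y (m k)) (y (n k)) (y (n k + 1))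
    · simpa using q (y (m k)) (y (m k + 1)) (y (n k)) (y (n k))
  have kp : ∀ k : ℕ, (0 : ℝ) < 1 / ((k : ℝ) + 1) := fun k => by positivity
  have H := hb (fun k => nndist (y (m k + 1)) (y (n k + 1))) (fun k => nndist (y (m k)) (y (n k)))
    (fun k => nndist (y (m k)) (y (m k + 1))) (fun k => nndist (y (n k)) (y (n k + 1)))
    (fun k => nndist (y (m k)) (y (n k + 1))) (fun k => nndist (y (m k + 1)) (y (n k)))
    (fun k => pos _ _ (by
      have := abs_le.1 (hd k).1
      linarith [k1 k, k3 k, k4 k]))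
    (fun k => pos _ _ (by linarith [k1 k]))
    (fun k => pos _ _ (dist_pos.2 (hpos _)))
    (fun k => pos _ _ (dist_pos.2 (hpos _)))
    (fun k => pos _ _ (by
      have := abs_le.1 (hd k).2.1
      linarith [k1 k, k3 k, k4 k]))
    (fun k => pos _ _ (by
      have := abs_le.1 (hd k).2.2
      linarith [k1 k, k3 k, k4 k]))
    (aux_tendsto _ _ fun k => by
      have := abs_le.1 (hd k).1
      rw [coe_nndist, abs_le]
      constructor <;> linarith [k1 k, k2 k, k5 k, k6 k, kp k])
    (aux_tendsto _ _ fun k => by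
      rw [coe_nndist, abs_le]
      constructor <;> linarith [k1 k, k2 k, k5 k, k6 k, kp k])
    (fun k => by
      have := k1 k
      exact_mod_cast this)
    (aux_tendsto _ _ fun k => by
      have := dist_nonneg (x := y (m k)) (y := y (m k + 1))
      rw [coe_nndist, abs_le, NNReal.coe_zero]
      constructor <;> linarith [k1 k, k2 k, k5 k, k6 k, kp k])
    (aux_tendsto _ _ fun k => by
      have := dist_nonneg (x := y (n k)) (y := y (n k + 1))
      rw [coe_nndist, abs_le, NNReal.coe_zero]
      constructor <;> linarith [k1 k, k2 k, k5 k, k6 k, kp k])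
    (aux_tendsto _ _ fun k => by
      have := abs_le.1 (hd k).2.1
      rw [coe_nndist, abs_le]
      constructor <;> linarith [k1 k, k2 k, k5 k, k6 k, kp k])
    (aux_tendsto _ _ fun k => by
      have := abs_le.1 (hd k).2.2
      rw [coe_nndist, abs_le]
      constructor <;> linarith [k1 k, k2 k, k5 k, k6 k, kp k])
  refine absurd H (not_lt.2 (aux_limsup_nonpos _ fun k => ?_))
  exact hc (m k) (n k) (hle _ _ (hmn k)) (dist_pos.1 (by linarith [k1 k]))

/-- **Theorem 3.1, part I (main result).**
Let `(X, d, le)` be a quasi-ordered metric space, complete for ascending Cauchy sequences,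
`T` a `le`-increasing selfmap with `{x : le x (T x)}` nonempty, and assume either `T` is
`le`-continuous or `le` is self-closed.  If `F : [0,∞)^6 → ℝ` is compatible, almost
2-right-lim-positive and 4-point-lim-positive, and `T` is `(d, le; M; F)`-contractive, then
`T` is a Picard operator: for each `x` with `le x (T x)`, `T^[n] x` converges to a fixed
point of `T`. -/
theorem picard_of_implicit_contraction
    {X : Type*} [MetricSpace X]
    (le : X → X → Prop)
    (hrefl : ∀ x, le x x)
    (htrans : ∀ x y z, le x y → le y z → le x z)
    (hcomplete : ∀ x : ℕ → X, (∀ n, le (x n) (x (n + 1))) → CauchySeq x →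
      ∃ a, Tendsto x atTop (nhds a))
    (T : X → X)
    (hmono : ∀ x y, le x y → le (T x) (T y))
    (hne : ∃ x, le x (T x))
    (hreg :
      (∀ (x : ℕ → X) (a : X), (∀ n, le (x n) (x (n + 1))) →
        Tendsto x atTop (nhds a) →
        Tendsto (fun n => T (x n)) atTop (nhds (T a)))
      ∨
      (∀ (x : ℕ → X) (a : X), (∀ n, le (x n) (x (n + 1))) →
        Tendsto x atTop (nhds a) → ∀ n, le (x n) a))
    (F : ℝ≥0 → ℝ≥0 → ℝ≥0 → ℝ≥0 → ℝ≥0 → ℝ≥0 → ℝ)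
    (hFcomp : FCompatible F)
    (hF2 : AlmostTwoRightLimPositive F)
    (hF4 : FourPointLimPositive F)
    (hcontr : ∀ x y, le x y → x ≠ y →
      F (nndist (T x) (T y)) (nndist x y) (nndist x (T x)) (nndist y (T y))
        (nndist x (T y)) (nndist (T x) y) ≤ 0) :
    ∀ x, le x (T x) →
      ∃ z, Tendsto (fun n => T^[n] x) atTop (nhds z) ∧ T z = z := by
  intro x hx
  have hsucc : ∀ n, T^[n+1] x = T (T^[n] x) := fun n => Function.iterate_succ_apply' T n x
  have hasc : ∀ n, le (T^[n] x) (T^[n+1] x) := by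
    intro n
    induction n with
    | zero => simpa using hx
    | succ k ih =>
      rw [hsucc (k+1), hsucc k]
      rw [hsucc k] at ih
      exact hmono _ _ ih
  by_cases hfix : ∃ n, T^[n] x = T^[n+1] x
  · obtain ⟨N, hN⟩ := hfix
    rw [hsucc] at hN
    refine ⟨T^[N] x, ?_, hN.symm⟩
    refine tendsto_const_nhds.congr' ?_
    filter_upwards [eventually_ge_atTop N] with n hn
    induction n, hn using Nat.le_induction with
    | base => rfl
    | succ k _ ih => rw [hsucc, ← ih, ← hN]
  push Not at hfix
  have hle : ∀ m n, m ≤ n → le (T^[m] x) (T^[n] x) := by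
    intro m n hmn
    induction n, hmn using Nat.le_induction with
    | base => exact hrefl _
    | succ k _ ih => exact htrans _ _ _ ih (hasc k)
  have hc : ∀ m n, le (T^[m] x) (T^[n] x) → T^[m] x ≠ T^[n] x →
      F (nndist (T^[m+1] x) (T^[n+1] x)) (nndist (T^[m] x) (T^[n] x))
        (nndist (T^[m] x) (T^[m+1] x)) (nndist (T^[n] x) (T^[n+1] x))
        (nndist (T^[m] x) (T^[n+1] x)) (nndist (T^[m+1] x) (T^[n] x)) ≤ 0 := by
    intro m n h1 h2
    rw [hsucc, hsucc]
    exact hcontr _ _ h1 h2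
  have hr := hFcomp (fun n => nndist (T^[n] x) (T^[n+1] x))
    (fun n => nndist (T^[n] x) (T^[n+1+1] x))
    (fun n => by
      have := dist_pos.2 (hfix n)
      exact_mod_cast this)
    (fun n => by
      have := hc n (n+1) (hasc n) (hfix n)
      rwa [nndist_self] at this)
    (fun n => by
      simp only [coe_nndist]
      rw [abs_le]
      have a1 := dist_triangle (T^[n] x) (T^[n+1] x) (T^[n+1+1] x)
      have a2 := dist_triangle_right (T^[n] x) (T^[n+1] x) (T^[n+1+1] x)
      constructor <;> linarith)
  have hr' : Tendsto (fun n => dist (T^[n] x) (T^[n+1] x)) atTop (nhds 0) := by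
    have := (NNReal.continuous_coe.tendsto 0).comp hr
    simpa [Function.comp_def] using this
  have hC := aux_cauchy le (fun n => T^[n] x) hle F hF2 hc hfix hr'
  obtain ⟨z, hz⟩ := hcomplete _ hasc hC
  refine ⟨z, hz, ?_⟩
  have hz1 : Tendsto (fun n => T^[n+1] x) atTop (nhds z) := (tendsto_add_atTop_iff_nat 1).2 hz
  rcases hreg with hreg | hreg
  · have h2 := hreg _ z hasc hz
    simp only [← hsucc] at h2
    exact tendsto_nhds_unique h2 hz1
  · have hlez := hreg _ z hasc hz
    by_contra hne'
    have hb : 0 < nndist z (T z) := by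
      have := dist_pos.2 (Ne.symm hne')
      exact_mod_cast this
    have e1 : Tendsto (fun n => nndist (T^[n+1] x) (T z)) atTop (nhds (nndist z (T z))) :=
      hz1.nndist tendsto_const_nhds
    have e2 : Tendsto (fun n => nndist (T^[n] x) z) atTop (nhds 0) := by
      simpa using hz.nndist (tendsto_const_nhds (x := z))
    have e5 : Tendsto (fun n => nndist (T^[n] x) (T z)) atTop (nhds (nndist z (T z))) :=
      hz.nndist tendsto_const_nhds
    have e6 : Tendsto (fun n => nndist (T^[n+1] x) z) atTop (nhds 0) := by
      simpa using hz1.nndist (tendsto_const_nhds (x := z))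
    have ev := (e1.eventually_const_lt hb).and ((e5.eventually_const_lt hb).and
      (hr.eventually_lt_const hb))
    obtain ⟨N, hN⟩ := eventually_atTop.1 ev
    have hnz : ∀ n, N ≤ n → T^[n] x ≠ z := by
      intro n hn h
      have := (hN n hn).2.2
      rw [hsucc, h] at this
      exact lt_irrefl _ this
    have npos : ∀ n, N ≤ n → 0 < nndist (T^[n] x) z := by
      intro n hn
      have := dist_pos.2 (hnz n hn)
      exact_mod_cast this
    have H := hF4 _ hb (fun k => nndist (T^[k+N+1] x) (T z)) (fun k => nndist (T^[k+N] x) z)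
      (fun k => nndist (T^[k+N] x) (T^[k+N+1] x)) (fun k => nndist (T^[k+N] x) (T z))
      (fun k => nndist (T^[k+N+1] x) z)
      (fun k => (hN (k+N) (by omega)).1)
      (fun k => npos _ (by omega))
      (fun k => by
        have := dist_pos.2 (hfix (k+N))
        exact_mod_cast this)
      (fun k => (hN (k+N) (by omega)).2.1)
      (fun k => npos _ (by omega))
      (e1.comp (tendsto_add_atTop_nat N)) (e2.comp (tendsto_add_atTop_nat N))
      (hr.comp (tendsto_add_atTop_nat N)) (e5.comp (tendsto_add_atTop_nat N))
      (e6.comp (tendsto_add_atTop_nat N))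
    refine absurd H (not_lt.2 (aux_limsup_nonpos _ fun k => ?_))
    have := hcontr (T^[k+N] x) z (hlez _) (hnz _ (by omega))
    rw [← hsucc] at this
    exact this
end

section
/- Let ψ : [0,∞) → [0,∞) be regressive (ψ(0) = 0 and ψ(t) < t for all t > 0), compatible (every sequence (r_n) in (0,∞) with r_n ≤ ψ(r_{n−1}) for all n ≥ 1 satisfies r_n → 0), and almost Boyd–Wong admissible (for every ε > 0 there exists s ∈ (0,ε) with max{ψ(s), limsup_{t→s+} ψ(t)} < s). Define F : [0,∞)^6 → ℝ by F(t_1,t_2,t_3,t_4,t_5,t_6) = t_1 − ψ(max{t_2, t_3, t_4, (t_5 + t_6)/2}). Then F is compatible, almost 2-right-lim-positive, 4-point-lim-positive, and (3,4)-normal. -/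
open Filter Topology
open scoped NNReal

lemma limsup_pos_aux {t : ℕ → ℝ≥0} {b c : ℝ≥0} {u : ℕ → ℝ}
    (ht : Tendsto t atTop (nhds b)) (hcb : c < b) (hu : ∀ n, u n ≤ t n)
    (hl : ∀ᶠ n in atTop, (t n : ℝ) - c ≤ u n) : 0 < limsup u atTop := by
  have hcb' : (c : ℝ) < b := NNReal.coe_lt_coe.mpr hcb
  have ht' : Tendsto (fun n => (t n : ℝ)) atTop (nhds (b : ℝ)) := NNReal.tendsto_coe.mpr ht
  have hbdd : IsBoundedUnder (· ≤ ·) atTop u :=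
    ht'.isBoundedUnder_le.mono_le (Eventually.of_forall hu)
  have h : ((b : ℝ) - c) / 2 ≤ limsup u atTop := by
    apply le_limsup_of_frequently_le _ hbdd
    apply Eventually.frequently
    filter_upwards [hl, ht'.eventually_const_lt (show ((b : ℝ) + c) / 2 < b by linarith)]
      with n h1 h2
    linarith
  linarith

/-- **Proposition 4.2.**
Let `ψ : [0,∞) → [0,∞)` be regressive (`ψ 0 = 0`, `ψ t < t` for `t > 0`), compatible
(every sequence `(r n)` in `(0,∞)` with `r (n+1) ≤ ψ (r n)` tends to `0`) and almost
Boyd–Wong admissible (for every `ε > 0` there is `s ∈ (0,ε)` with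
`max (ψ s) (limsup_{t → s+} ψ t) < s`).  Then the function
`F (t₁,…,t₆) = t₁ - ψ (max {t₂, t₃, t₄, (t₅+t₆)/2})` is compatible, almost
2-right-lim-positive, 4-point-lim-positive, and (3,4)-normal. -/
theorem implicit_function_of_explicit_contraction
    (ψ : ℝ≥0 → ℝ≥0)
    (hψ_zero : ψ 0 = 0)
    (hψ_lt : ∀ t : ℝ≥0, 0 < t → ψ t < t)
    (hψ_comp : ∀ r : ℕ → ℝ≥0, (∀ n, 0 < r n) → (∀ n, r (n + 1) ≤ ψ (r n)) →
      Tendsto r atTop (nhds 0))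
    (hψ_aBW : ∀ ε : ℝ≥0, 0 < ε → ∃ s : ℝ≥0, 0 < s ∧ s < ε ∧
      max (ψ s) (limsup ψ (nhdsWithin s (Set.Ioi s))) < s)
    (F : ℝ≥0 → ℝ≥0 → ℝ≥0 → ℝ≥0 → ℝ≥0 → ℝ≥0 → ℝ)
    (hF : ∀ t₁ t₂ t₃ t₄ t₅ t₆ : ℝ≥0,
      F t₁ t₂ t₃ t₄ t₅ t₆ = (t₁ : ℝ) - (ψ (max t₂ (max t₃ (max t₄ ((t₅ + t₆) / 2)))) : ℝ)) :
    FCompatible F ∧ AlmostTwoRightLimPositive F ∧ FourPointLimPositive F ∧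
      (∀ r : ℝ≥0, 0 < r → 0 < F r r 0 0 r r) := by
  refine ⟨?_, ?_, ?_, ?_⟩
  · intro r s hr h1 h2
    refine hψ_comp r hr fun n => ?_
    have h := h1 n
    rw [hF] at h
    have h3 : r (n + 1) ≤ ψ (max (r n) (max (r n) (max (r (n + 1)) ((s n + 0) / 2)))) := by
      rw [← NNReal.coe_le_coe]; linarith
    have h4 : (s n : ℝ) ≤ r n + r (n + 1) := by
      have := (abs_le.mp (h2 n)).2
      linarith
    have h5 : (s n + 0) / 2 ≤ max (r n) (r (n + 1)) := by
      rw [← NNReal.coe_le_coe]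
      push_cast
      have := le_max_left (r n : ℝ) (r (n + 1))
      have := le_max_right (r n : ℝ) (r (n + 1))
      linarith
    have h6 : max (r n) (max (r n) (max (r (n + 1)) ((s n + 0) / 2)))
        = max (r n) (r (n + 1)) := by
      apply le_antisymm
      · exact max_le (le_max_left _ _) (max_le (le_max_left _ _) (max_le (le_max_right _ _) h5))
      · exact max_le (le_max_left _ _)
          (le_trans (le_max_left _ _) (le_trans (le_max_right _ _) (le_max_right _ _)))
    rw [h6] at h3
    rcases le_total (r n) (r (n + 1)) with h7 | h7
    · rw [max_eq_right h7] at h3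
      exact absurd (hψ_lt _ (hr (n + 1))) (not_lt.mpr h3)
    · rwa [max_eq_left h7] at h3
  · intro ε hε
    obtain ⟨b, hb, hbε, hlim⟩ := hψ_aBW ε hε
    refine ⟨b, hb, hbε, ?_⟩
    intro t₁ t₂ t₃ t₄ t₅ t₆ _ _ _ _ _ _ h1 h2 h2b h3 h4 h5 h6
    have hl := lt_of_le_of_lt (le_max_right _ _) hlim
    obtain ⟨c, hc1, hcb⟩ := exists_between hl
    have hbdd : IsBoundedUnder (· ≤ ·) (nhdsWithin b (Set.Ioi b)) ψ := by
      refine ⟨b + 1, ?_⟩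
      rw [eventually_map]
      have : ∀ᶠ x in nhdsWithin b (Set.Ioi b), x < b + 1 :=
        nhdsWithin_le_nhds (Iio_mem_nhds (lt_add_of_pos_right b one_pos))
      filter_upwards [this, self_mem_nhdsWithin] with x hx hx'
      exact ((hψ_lt x (hb.trans hx')).trans hx).le
    have hev := eventually_lt_of_limsup_lt hc1 hbdd
    have hm : Tendsto (fun n => max (t₂ n) (max (t₃ n) (max (t₄ n) ((t₅ n + t₆ n) / 2))))
        atTop (nhds b) := by
      have := h2.max (h3.max (h4.max ((h5.add h6).div_const 2)))
      simpa using this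
    have hm' : Tendsto (fun n => max (t₂ n) (max (t₃ n) (max (t₄ n) ((t₅ n + t₆ n) / 2))))
        atTop (nhdsWithin b (Set.Ioi b)) :=
      tendsto_nhdsWithin_iff.mpr ⟨hm, Eventually.of_forall fun n =>
        lt_of_lt_of_le (h2b n) (le_max_left _ _)⟩
    refine limsup_pos_aux h1 hcb (fun n => ?_) ?_
    · rw [hF]; exact sub_le_self _ (NNReal.coe_nonneg _)
    · filter_upwards [hm'.eventually hev] with n hn
      rw [hF]
      exact sub_le_sub_left (NNReal.coe_le_coe.mpr hn.le) _
  · intro b hb t₁ t₂ t₃ t₅ t₆ _ _ _ _ _ h1 h2 h3 h5 h6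
    have h56 : Tendsto (fun n => (t₅ n + t₆ n) / 2) atTop (nhds (b / 2)) := by
      simpa using (h5.add h6).div_const 2
    refine limsup_pos_aux h1 (hψ_lt b hb) (fun n => ?_) ?_
    · rw [hF]; exact sub_le_self _ (NNReal.coe_nonneg _)
    · filter_upwards [h2.eventually_lt_const hb, h3.eventually_lt_const hb,
        h56.eventually_lt_const (NNReal.half_lt_self hb.ne')] with n a2 a3 a5
      rw [hF, max_eq_left a5.le, max_eq_right a3.le, max_eq_right a2.le]
  · intro r hr
    have h : max r (max 0 (max 0 ((r + r) / 2))) = r := by simp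
    rw [hF, h]
    exact sub_pos.mpr (NNReal.coe_lt_coe.mpr (hψ_lt r hr))
end

section
/- Let (X,d,≤) be a quasi-ordered metric space which is complete (every ascending Cauchy sequence converges), let T : X → X be ≤-increasing with {x ∈ X : x ≤ Tx} nonempty, and suppose that either T is ≤-continuous or the relation ≤ is self-closed. Let ψ : [0,∞) → [0,∞) be regressive (ψ(0) = 0, ψ(t) < t for t > 0), compatible, and almost Boyd–Wong admissible, and assume that d(Tx,Ty) ≤ ψ(max{d(x,y), d(x,Tx), d(y,Ty), (d(x,Ty) + d(Tx,y))/2}) for all x,y ∈ X with x ≤ y and x ≠ y. Then T is a Picard operator modulo (d,≤): for every x ∈ X with x ≤ Tx the sequence (T^n x) converges and its limit is a fixed point of T. -/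
open Filter Topology
open scoped NNReal

/-- **Theorem 4.3.**
Let `(X, d, le)` be a quasi-ordered metric space, complete for ascending Cauchy sequences,
`T` a `le`-increasing selfmap with `{x : le x (T x)}` nonempty, and assume either `T` is
`le`-continuous or `le` is self-closed.  If `ψ : [0,∞) → [0,∞)` is regressive, compatible
and almost Boyd–Wong admissible, and
`d (T x) (T y) ≤ ψ (max {d x y, d x (T x), d y (T y), (d x (T y) + d (T x) y)/2})`
for all `x ≤ y`, `x ≠ y`, then `T` is a Picard operator. -/
theorem picard_of_explicit_contraction_almost_boydWong
    {X : Type*} [MetricSpace X]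
    (le : X → X → Prop)
    (hrefl : ∀ x, le x x)
    (htrans : ∀ x y z, le x y → le y z → le x z)
    (hcomplete : ∀ x : ℕ → X, (∀ n, le (x n) (x (n + 1))) → CauchySeq x →
      ∃ a, Tendsto x atTop (nhds a))
    (T : X → X)
    (hmono : ∀ x y, le x y → le (T x) (T y))
    (hne : ∃ x, le x (T x))
    (hreg :
      (∀ (x : ℕ → X) (a : X), (∀ n, le (x n) (x (n + 1))) →
        Tendsto x atTop (nhds a) →
        Tendsto (fun n => T (x n)) atTop (nhds (T a)))
      ∨
      (∀ (x : ℕ → X) (a : X), (∀ n, le (x n) (x (n + 1))) →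
        Tendsto x atTop (nhds a) → ∀ n, le (x n) a))
    (ψ : ℝ≥0 → ℝ≥0)
    (hψ_zero : ψ 0 = 0)
    (hψ_lt : ∀ t : ℝ≥0, 0 < t → ψ t < t)
    (hψ_comp : ∀ r : ℕ → ℝ≥0, (∀ n, 0 < r n) → (∀ n, r (n + 1) ≤ ψ (r n)) →
      Tendsto r atTop (nhds 0))
    (hψ_aBW : ∀ ε : ℝ≥0, 0 < ε → ∃ s : ℝ≥0, 0 < s ∧ s < ε ∧
      max (ψ s) (limsup ψ (nhdsWithin s (Set.Ioi s))) < s)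
    (hcontr : ∀ x y, le x y → x ≠ y →
      nndist (T x) (T y) ≤ ψ (max (nndist x y) (max (nndist x (T x))
        (max (nndist y (T y)) ((nndist x (T y) + nndist (T x) y) / 2))))) :
    ∀ x, le x (T x) →
      ∃ z, Tendsto (fun n => T^[n] x) atTop (nhds z) ∧ T z = z := by
  intro x0 hx0
  -- orbit
  obtain ⟨x, hxdef⟩ : ∃ x : ℕ → X, x = fun n => T^[n] x0 := ⟨_, rfl⟩
  have hT : ∀ n, T (x n) = x (n + 1) := by
    intro n; rw [hxdef]; simp only [Function.iterate_succ_apply']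
  rw [← hxdef]
  have hasc : ∀ n, le (x n) (x (n + 1)) := by
    intro n
    induction n with
    | zero => rw [← hT 0]; rw [hxdef]; simpa using hx0
    | succ k ih =>
      have := hmono _ _ ih
      rwa [hT, hT] at this
  have hle : ∀ n k, le (x n) (x (n + k)) := by
    intro n k
    induction k with
    | zero => exact hrefl _
    | succ k ih => exact htrans _ _ _ ih (hasc _)
  have hψle : ∀ t, ψ t ≤ t := by
    intro t
    rcases eq_or_ne t 0 with h | h
    · rw [h, hψ_zero]
    · exact (hψ_lt t (pos_iff_ne_zero.2 h)).le
  by_cases hfix : ∃ n, x n = x (n + 1)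
  · obtain ⟨n, hn⟩ := hfix
    have hc : ∀ k, x (n + k) = x n := by
      intro k
      induction k with
      | zero => rfl
      | succ k ih => rw [← add_assoc, ← hT, ih, hT, ← hn]
    refine ⟨x n, ?_, by rw [hT, ← hn]⟩
    apply tendsto_const_nhds.congr'
    filter_upwards [eventually_ge_atTop n] with m hm
    obtain ⟨k, rfl⟩ := Nat.exists_eq_add_of_le hm
    exact (hc k).symm
  push Not at hfix
  have hrpos : ∀ n, 0 < nndist (x n) (x (n + 1)) := fun n =>
    pos_iff_ne_zero.2 (by simpa [nndist_eq_zero] using hfix n)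
  have hr : Tendsto (fun n => nndist (x n) (x (n + 1))) atTop (nhds 0) := by
    apply hψ_comp _ hrpos
    intro n
    have h := hcontr _ _ (hasc n) (hfix n)
    simp only [hT] at h
    have tri := nndist_triangle (x n) (x (n + 1)) (x (n + 1 + 1))
    have hp := hrpos (n + 1)
    rw [nndist_self, add_zero] at h
    generalize nndist (x n) (x (n + 1)) = a at *
    generalize nndist (x (n + 1)) (x (n + 1 + 1)) = b at *
    generalize nndist (x n) (x (n + 1 + 1)) = c at *
    have hc : c / 2 ≤ max a b := by
      rw [← NNReal.coe_le_coe] at tri ⊢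
      push_cast at tri ⊢
      have := le_max_left (a : ℝ) b
      have := le_max_right (a : ℝ) b
      linarith
    have hM : max a (max a (max b (c / 2))) = max a b := by
      apply le_antisymm
      · exact max_le (le_max_left _ _) (max_le (le_max_left _ _) (max_le (le_max_right _ _) hc))
      · exact max_le_max le_rfl ((le_max_left _ _).trans (le_max_right _ _))
    rw [hM] at h
    rcases le_total b a with hba | hab
    · rwa [max_eq_left hba] at h
    · rw [max_eq_right hab] at h
      exact absurd h (not_le.2 (hψ_lt b hp))
  have hcau : CauchySeq x := by
    rw [Metric.cauchySeq_iff']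
    intro ε hε
    obtain ⟨s, hs0, hsε, hs⟩ := hψ_aBW (Real.toNNReal (ε / 2))
      (Real.toNNReal_pos.2 (half_pos hε))
    have hsε' : (s : ℝ) < ε / 2 := Real.lt_toNNReal_iff_coe_lt.1 hsε
    obtain ⟨hs1, hs2⟩ := max_lt_iff.1 hs
    have hbdd : IsBoundedUnder (· ≤ ·) (nhdsWithin s (Set.Ioi s)) ψ := by
      refine ⟨s + 1, ?_⟩
      rw [eventually_map]
      have : ∀ᶠ t in nhdsWithin s (Set.Ioi s), t < s + 1 :=
        mem_nhdsWithin_of_mem_nhds (Iio_mem_nhds (lt_add_of_pos_right s one_pos))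
      filter_upwards [this] with t ht
      exact (hψle t).trans ht.le
    have hev := eventually_lt_of_limsup_lt hs2 hbdd
    obtain ⟨u, hu, hus⟩ := (mem_nhdsGT_iff_exists_Ioo_subset (a := s)).1 hev
    have hu' : s < u := hu
    have hψs : ∀ t, t < u → ψ t < s := by
      intro t ht
      rcases lt_trichotomy t s with h | h | h
      · exact (hψle t).trans_lt h
      · rw [h]; exact hs1
      · exact hus ⟨h, ht⟩
    have hu'' : (s : ℝ) < u := NNReal.coe_lt_coe.2 hu'
    obtain ⟨β, hβ0, hβ1, hβ2⟩ : ∃ β : ℝ, 0 < β ∧ s + 2 * β ≤ u ∧ β ≤ ε / 2 := by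
      refine ⟨min ((u - s) / 2) (ε / 2), lt_min (by linarith) (by linarith), ?_, min_le_right _ _⟩
      have := min_le_left (((u : ℝ) - s) / 2) (ε / 2)
      linarith
    have hrd : ∀ᶠ n in atTop, dist (x n) (x (n + 1)) < β := by
      have h2 : Tendsto (fun n => ((nndist (x n) (x (n + 1)) : ℝ≥0) : ℝ)) atTop (nhds 0) :=
        NNReal.tendsto_coe.2 hr
      exact h2.eventually (gt_mem_nhds hβ0)
    obtain ⟨N, hN⟩ := eventually_atTop.1 hrd
    have key : ∀ k, dist (x N) (x (N + k)) < s + β := by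
      intro k
      induction k with
      | zero =>
        rw [add_zero, dist_self]
        have : (0 : ℝ) ≤ s := s.2
        linarith
      | succ k ih =>
        have hrN := hN N le_rfl
        have hrm := hN (N + k) (by omega)
        rw [← add_assoc]
        have hs' : (0 : ℝ) < s := hs0
        by_cases heq : x N = x (N + k)
        · rw [heq]; linarith
        have h := hcontr _ _ (hle N k) heq
        simp only [hT] at h
        have t1 := dist_triangle (x N) (x (N + k)) (x (N + k + 1))
        have t2 := dist_triangle_left (x (N + 1)) (x (N + k)) (x N)
        have t3 := dist_triangle (x N) (x (N + 1)) (x (N + k + 1))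
        have hMu := hψs _ (show max (nndist (x N) (x (N + k))) (max (nndist (x N) (x (N + 1)))
            (max (nndist (x (N + k)) (x (N + k + 1)))
            ((nndist (x N) (x (N + k + 1)) + nndist (x (N + 1)) (x (N + k))) / 2))) < u by
          rw [← NNReal.coe_lt_coe]
          push_cast
          simp only [max_lt_iff]
          refine ⟨?_, ?_, ?_, ?_⟩ <;> linarith)
        have h3 : dist (x (N + 1)) (x (N + k + 1)) < s := by
          have := NNReal.coe_lt_coe.2 (h.trans_lt hMu)
          simpa using this
        linarith
    refine ⟨N, fun n hn => ?_⟩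
    obtain ⟨k, rfl⟩ := Nat.exists_eq_add_of_le hn
    rw [dist_comm]
    have := key k
    linarith
  obtain ⟨z, hz⟩ := hcomplete x hasc hcau
  refine ⟨z, hz, ?_⟩
  have hz1 : Tendsto (fun n => x (n + 1)) atTop (nhds z) := hz.comp (tendsto_add_atTop_nat 1)
  rcases hreg with hcont | hsc
  · have h := hcont x z hasc hz
    simp only [hT] at h
    exact tendsto_nhds_unique h hz1
  · by_contra hne'
    have hxz := hsc x z hasc hz
    have hb : 0 < nndist z (T z) :=
      pos_iff_ne_zero.2 (by simpa [nndist_eq_zero] using Ne.symm hne')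
    have e1 : ∀ᶠ n in atTop, nndist (x n) (x (n + 1)) < nndist z (T z) :=
      hr.eventually (gt_mem_nhds hb)
    have d1 : Tendsto (fun n => nndist (x n) z) atTop (nhds 0) := by
      simpa using hz.nndist (tendsto_const_nhds (x := z))
    have e2 : ∀ᶠ n in atTop, nndist (x n) z < nndist z (T z) :=
      d1.eventually (gt_mem_nhds hb)
    have d3 : Tendsto (fun n => (nndist (x n) (T z) + nndist (x (n + 1)) z) / 2) atTop
        (nhds ((nndist z (T z) + nndist z z) / 2)) :=
      ((hz.nndist tendsto_const_nhds).add (hz1.nndist tendsto_const_nhds)).div_const 2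
    have e3 : ∀ᶠ n in atTop,
        (nndist (x n) (T z) + nndist (x (n + 1)) z) / 2 < nndist z (T z) := by
      apply d3.eventually (gt_mem_nhds _)
      rw [nndist_self, add_zero]
      exact NNReal.half_lt_self hb.ne'
    have hlim : Tendsto (fun n => nndist (x (n + 1)) (T z)) atTop (nhds (nndist z (T z))) :=
      hz1.nndist tendsto_const_nhds
    have hfin : nndist z (T z) ≤ ψ (nndist z (T z)) := by
      apply le_of_tendsto hlim
      filter_upwards [e1, e2, e3] with n h1 h2 h3
      have hn : x n ≠ z := by
        intro h
        rw [← hT, h] at h1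
        exact lt_irrefl _ h1
      have h := hcontr _ _ (hxz n) hn
      simp only [hT] at h
      rwa [max_eq_left h3.le, max_eq_right h1.le, max_eq_right h2.le] at h
    exact absurd hfin (not_le.2 (hψ_lt _ hb))
end

section
/- Every Matkowski function ψ (i.e. ψ : [0,∞) → [0,∞) increasing, with ψ(0) = 0, ψ(t) < t for all t > 0, and ψ^n(t) → 0 for every t > 0) is compatible (every sequence (r_n) in (0,∞) with r_n ≤ ψ(r_{n−1}) for all n ≥ 1 satisfies r_n → 0) and almost Boyd–Wong admissible (for every ε > 0 there exists s ∈ (0,ε) with max{ψ(s), limsup_{t→s+} ψ(t)} < s). -/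
open Filter Topology
open scoped NNReal

/-- **Section 4, B-1.**
Every Matkowski function `ψ` (increasing, `ψ 0 = 0`, `ψ t < t` for `t > 0`, `ψ^[n] t → 0`
for all `t > 0`) is compatible (every sequence `(r n)` in `(0,∞)` with `r (n+1) ≤ ψ (r n)`
tends to `0`) and almost Boyd–Wong admissible (for every `ε > 0` there is `s ∈ (0,ε)` with
`max (ψ s) (limsup_{t → s+} ψ t) < s`). -/
theorem matkowski_compatible_and_almost_boydWong
    (ψ : ℝ≥0 → ℝ≥0)
    (hψ_mono : Monotone ψ)
    (hψ_zero : ψ 0 = 0)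
    (hψ_lt : ∀ t : ℝ≥0, 0 < t → ψ t < t)
    (hψ_iter : ∀ t : ℝ≥0, 0 < t → Tendsto (fun n => ψ^[n] t) atTop (nhds 0)) :
    (∀ r : ℕ → ℝ≥0, (∀ n, 0 < r n) → (∀ n, r (n + 1) ≤ ψ (r n)) →
      Tendsto r atTop (nhds 0)) ∧
    (∀ ε : ℝ≥0, 0 < ε → ∃ s : ℝ≥0, 0 < s ∧ s < ε ∧
      max (ψ s) (limsup ψ (nhdsWithin s (Set.Ioi s))) < s) := by
  refine ⟨?_, ?_⟩
  · intro r hr hle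
    have key : ∀ n, r n ≤ ψ^[n] (r 0) := by
      intro n
      induction n with
      | zero => simp
      | succ k ih =>
        rw [Function.iterate_succ_apply']
        exact (hle k).trans (hψ_mono ih)
    exact tendsto_of_tendsto_of_tendsto_of_le_of_le tendsto_const_nhds
      (hψ_iter (r 0) (hr 0)) (fun n => zero_le) key
  · intro ε hε
    obtain ⟨t, ht0, htε⟩ := exists_between hε
    obtain ⟨s, hs, hst⟩ := exists_between (hψ_lt t ht0)
    have hs0 : 0 < s := lt_of_le_of_lt zero_le hs
    refine ⟨s, hs0, hst.trans htε, max_lt (hψ_lt s hs0) ?_⟩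
    have hev : ∀ᶠ u in nhdsWithin s (Set.Ioi s), ψ u ≤ ψ t := by
      filter_upwards [mem_nhdsWithin_of_mem_nhds (Iio_mem_nhds hst)] with u hu
      exact hψ_mono (le_of_lt hu)
    refine lt_of_le_of_lt ?_ hs
    rw [limsup_eq]
    exact csInf_le ⟨0, fun _ _ => zero_le⟩ hev
end

section
/- Let (X,d,≤) be a quasi-ordered metric space which is complete (every ascending Cauchy sequence converges), let T : X → X be ≤-increasing with {x ∈ X : x ≤ Tx} nonempty, and suppose that either T is ≤-continuous or the relation ≤ is self-closed. Let ψ be a Matkowski function (ψ : [0,∞) → [0,∞) increasing, ψ(0) = 0, ψ(t) < t for all t > 0, ψ^n(t) → 0 for every t > 0), and assume that d(Tx,Ty) ≤ ψ(max{d(x,y), d(x,Tx), d(y,Ty), (d(x,Ty) + d(Tx,y))/2}) for all x,y ∈ X with x ≤ y and x ≠ y. Then T is a Picard operator modulo (d,≤): for every x ∈ X with x ≤ Tx the sequence (T^n x) converges and its limit is a fixed point of T. -/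
open Filter Topology
open scoped NNReal

/-- **Section 4, B-1 (Agarwal–El-Gebeily–O'Regan, 2008).**
Let `(X, d, le)` be a quasi-ordered metric space, complete for ascending Cauchy sequences,
`T` a `le`-increasing selfmap with `{x : le x (T x)}` nonempty, and assume either `T` is
`le`-continuous or `le` is self-closed.  If `ψ` is a Matkowski function and
`d (T x) (T y) ≤ ψ (max {d x y, d x (T x), d y (T y), (d x (T y) + d (T x) y)/2})`
for all `x ≤ y`, `x ≠ y`, then `T` is a Picard operator. -/
theorem picard_of_explicit_contraction_matkowski
    {X : Type*} [MetricSpace X]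
    (le : X → X → Prop)
    (hrefl : ∀ x, le x x)
    (htrans : ∀ x y z, le x y → le y z → le x z)
    (hcomplete : ∀ x : ℕ → X, (∀ n, le (x n) (x (n + 1))) → CauchySeq x →
      ∃ a, Tendsto x atTop (nhds a))
    (T : X → X)
    (hmono : ∀ x y, le x y → le (T x) (T y))
    (hne : ∃ x, le x (T x))
    (hreg :
      (∀ (x : ℕ → X) (a : X), (∀ n, le (x n) (x (n + 1))) →
        Tendsto x atTop (nhds a) →
        Tendsto (fun n => T (x n)) atTop (nhds (T a)))
      ∨
      (∀ (x : ℕ → X) (a : X), (∀ n, le (x n) (x (n + 1))) →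
        Tendsto x atTop (nhds a) → ∀ n, le (x n) a))
    (ψ : ℝ≥0 → ℝ≥0)
    (hψ_mono : Monotone ψ)
    (hψ_zero : ψ 0 = 0)
    (hψ_lt : ∀ t : ℝ≥0, 0 < t → ψ t < t)
    (hψ_iter : ∀ t : ℝ≥0, 0 < t → Tendsto (fun n => ψ^[n] t) atTop (nhds 0))
    (hcontr : ∀ x y, le x y → x ≠ y →
      nndist (T x) (T y) ≤ ψ (max (nndist x y) (max (nndist x (T x))
        (max (nndist y (T y)) ((nndist x (T y) + nndist (T x) y) / 2))))) :
    ∀ x, le x (T x) →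
      ∃ z, Tendsto (fun n => T^[n] x) atTop (nhds z) ∧ T z = z := by
  have key : ∀ x y, le x y → ∀ c : ℝ≥0, dist x y ≤ c → dist x (T x) ≤ c → dist y (T y) ≤ c →
      dist x (T y) + dist (T x) y ≤ 2 * c → dist (T x) (T y) ≤ ψ c := by
    intro x y hxy c h1 h2 h3 h4
    by_cases h : x = y
    · subst h
      simp
    · have h5 := hcontr x y hxy h
      have h6 : max (nndist x y) (max (nndist x (T x))
        (max (nndist y (T y)) ((nndist x (T y) + nndist (T x) y) / 2))) ≤ c := by
        refine max_le ?_ (max_le ?_ (max_le ?_ ?_)) <;> rw [← NNReal.coe_le_coe]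
        · simpa using h1
        · simpa using h2
        · simpa using h3
        · push_cast
          linarith
      have h7 := h5.trans (hψ_mono h6)
      rw [← NNReal.coe_le_coe] at h7
      simpa using h7
  intro x0 hx0
  set u : ℕ → X := fun n => T^[n] x0 with hu
  have hus : ∀ n, u (n + 1) = T (u n) := fun n => Function.iterate_succ_apply' T n x0
  have hasc : ∀ n, le (u n) (u (n + 1)) := by
    intro n
    induction n with
    | zero => simpa [hu] using hx0
    | succ k ih =>
      rw [hus (k + 1)]
      have := hmono _ _ ih
      rwa [← hus k] at this
  have hle : ∀ n k, le (u n) (u (n + k)) := by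
    intro n k
    induction k with
    | zero => exact hrefl _
    | succ k ih => exact htrans _ _ _ ih (hasc (n + k))
  have hstep : ∀ n, nndist (u (n + 1)) (u (n + 1 + 1)) ≤ ψ (nndist (u n) (u (n + 1))) := by
    intro n
    have hk := key (u n) (u (n + 1)) (hasc n)
      (max (nndist (u n) (u (n + 1))) (nndist (u (n + 1)) (u (n + 1 + 1))))
    rw [← hus, ← hus] at hk
    have ha : dist (u n) (u (n + 1)) ≤ (max (nndist (u n) (u (n + 1)))
        (nndist (u (n + 1)) (u (n + 1 + 1))) : ℝ≥0) := by
      simp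
    have hb : dist (u (n + 1)) (u (n + 1 + 1)) ≤ (max (nndist (u n) (u (n + 1)))
        (nndist (u (n + 1)) (u (n + 1 + 1))) : ℝ≥0) := by
      simp
    have hk' := hk ha ha hb (by
      rw [dist_self]
      linarith [dist_triangle (u n) (u (n + 1)) (u (n + 1 + 1))])
    rw [← coe_nndist, NNReal.coe_le_coe] at hk'
    rcases le_total (nndist (u (n + 1)) (u (n + 1 + 1))) (nndist (u n) (u (n + 1))) with h | h
    · rwa [max_eq_left h] at hk'
    · rw [max_eq_right h] at hk'
      rcases eq_or_lt_of_le (zero_le : 0 ≤ nndist (u (n + 1)) (u (n + 1 + 1))) with h0 | h0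
      · rw [← h0]
        exact zero_le
      · exact absurd hk' (not_le.mpr (hψ_lt _ h0))
  have hit : ∀ n, nndist (u n) (u (n + 1)) ≤ ψ^[n] (nndist (u 0) (u 1) + 1) := by
    intro n
    induction n with
    | zero => simp
    | succ k ih =>
      rw [Function.iterate_succ_apply']
      exact (hstep k).trans (hψ_mono ih)
  have hd0 : ∀ δ : ℝ, 0 < δ → ∃ N, ∀ n, N ≤ n → dist (u n) (u (n + 1)) ≤ δ := by
    intro δ hδ
    have h := hψ_iter (nndist (u 0) (u 1) + 1) (by positivity)
    have h2 := h.eventually (gt_mem_nhds (Real.toNNReal_pos.mpr hδ))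
    obtain ⟨N, hN⟩ := eventually_atTop.mp h2
    refine ⟨N, fun n hn => ?_⟩
    have h3 := (hit n).trans (hN n hn).le
    rw [← NNReal.coe_le_coe, Real.coe_toNNReal _ hδ.le] at h3
    simpa using h3
  have hcau : CauchySeq u := by
    rw [Metric.cauchySeq_iff']
    intro ε hε
    have hpl := hψ_lt ε.toNNReal (Real.toNNReal_pos.mpr hε)
    rw [← NNReal.coe_lt_coe, Real.coe_toNNReal _ hε.le] at hpl
    have hpn : (0 : ℝ) ≤ ψ ε.toNNReal := NNReal.coe_nonneg _
    obtain ⟨δ, hδ⟩ : ∃ δ : ℝ, δ = (ε - ψ ε.toNNReal) / 2 := ⟨_, rfl⟩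
    obtain ⟨N, hN⟩ := hd0 δ (by linarith)
    have main : ∀ k, dist (u N) (u (N + k)) ≤ ε - δ := by
      intro k
      induction k with
      | zero =>
        simp only [add_zero, dist_self]
        linarith
      | succ k ih =>
        have a1 := hN N le_rfl
        have a2 := hN (N + k) (by omega)
        have hk := key (u N) (u (N + k)) (hle N k) ε.toNNReal
        rw [← hus, ← hus, Real.coe_toNNReal _ hε.le] at hk
        have t1 := dist_triangle (u N) (u (N + k)) (u (N + k + 1))
        have t2 := dist_triangle_left (u (N + 1)) (u (N + k)) (u N)
        have t3 := dist_triangle (u N) (u (N + 1)) (u (N + k + 1))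
        have hk' := hk (by linarith) (by linarith) (by linarith) (by linarith)
        change dist (u N) (u (N + k + 1)) ≤ _
        linarith
    refine ⟨N, fun n hn => ?_⟩
    obtain ⟨k, rfl⟩ := Nat.exists_eq_add_of_le hn
    rw [dist_comm]
    linarith [main k]
  obtain ⟨z, hz⟩ := hcomplete u hasc hcau
  refine ⟨z, hz, ?_⟩
  have hz1 : Tendsto (fun n => u (n + 1)) atTop (nhds z) := hz.comp (tendsto_add_atTop_nat 1)
  rcases hreg with hc | hs
  · have h := hc u z hasc hz
    simp only [← hus] at h
    exact tendsto_nhds_unique h hz1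
  · by_contra hne'
    have hpos : 0 < nndist z (T z) := by
      rw [pos_iff_ne_zero, Ne, nndist_eq_zero]
      exact fun h => hne' h.symm
    have hlt := hψ_lt _ hpos
    rw [← NNReal.coe_lt_coe, coe_nndist] at hlt
    rw [← NNReal.coe_pos, coe_nndist] at hpos
    have hpn : (0 : ℝ) ≤ ψ (nndist z (T z)) := NNReal.coe_nonneg _
    obtain ⟨δ, hδ⟩ : ∃ δ : ℝ, δ = (dist z (T z) - ψ (nndist z (T z))) / 4 := ⟨_, rfl⟩
    have hδ0 : 0 < δ := by linarith
    obtain ⟨N, hN⟩ := Metric.tendsto_atTop.mp hz δ hδ0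
    have b1 := hN N le_rfl
    have b2 := hN (N + 1) (by omega)
    have hk := key (u N) z (hs u z hasc hz N) (nndist z (T z))
    rw [← hus, coe_nndist] at hk
    have t1 := dist_triangle_right (u N) (u (N + 1)) z
    have t2 := dist_triangle (u N) z (T z)
    have t3 := dist_triangle_left z (T z) (u (N + 1))
    have hk' := hk (by linarith) (by linarith) le_rfl (by linarith)
    linarith
end

section
/- Let (X,d,≤) be a quasi-ordered metric space which is complete (every ascending Cauchy sequence converges), let T : X → X be ≤-increasing with {x ∈ X : x ≤ Tx} nonempty, and suppose that either T is ≤-continuous or the relation ≤ is self-closed. Let ψ : [0,∞) → [0,∞) be regressive (ψ(0) = 0, ψ(t) < t for t > 0) and Boyd–Wong admissible (limsup_{t→s+} ψ(t) < s for every s > 0), and assume that d(Tx,Ty) ≤ ψ(max{d(x,y), d(x,Tx), d(y,Ty), (d(x,Ty) + d(Tx,y))/2}) for all x,y ∈ X with x ≤ y and x ≠ y. Then T is a Picard operator modulo (d,≤): for every x ∈ X with x ≤ Tx the sequence (T^n x) converges and its limit is a fixed point of T. -/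
open Filter Topology
open scoped NNReal

/-- **Section 4, B-2 (Boyd–Wong type).**
Let `(X, d, le)` be a quasi-ordered metric space, complete for ascending Cauchy sequences,
`T` a `le`-increasing selfmap with `{x : le x (T x)}` nonempty, and assume either `T` is
`le`-continuous or `le` is self-closed.  If `ψ : [0,∞) → [0,∞)` is regressive and
Boyd–Wong admissible (`limsup_{t → s+} ψ t < s` for all `s > 0`), and
`d (T x) (T y) ≤ ψ (max {d x y, d x (T x), d y (T y), (d x (T y) + d (T x) y)/2})`
for all `x ≤ y`, `x ≠ y`, then `T` is a Picard operator. -/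
theorem picard_of_explicit_contraction_boydWong
    {X : Type*} [MetricSpace X]
    (le : X → X → Prop)
    (hrefl : ∀ x, le x x)
    (htrans : ∀ x y z, le x y → le y z → le x z)
    (hcomplete : ∀ x : ℕ → X, (∀ n, le (x n) (x (n + 1))) → CauchySeq x →
      ∃ a, Tendsto x atTop (nhds a))
    (T : X → X)
    (hmono : ∀ x y, le x y → le (T x) (T y))
    (hne : ∃ x, le x (T x))
    (hreg :
      (∀ (x : ℕ → X) (a : X), (∀ n, le (x n) (x (n + 1))) →
        Tendsto x atTop (nhds a) →
        Tendsto (fun n => T (x n)) atTop (nhds (T a)))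
      ∨
      (∀ (x : ℕ → X) (a : X), (∀ n, le (x n) (x (n + 1))) →
        Tendsto x atTop (nhds a) → ∀ n, le (x n) a))
    (ψ : ℝ≥0 → ℝ≥0)
    (hψ_zero : ψ 0 = 0)
    (hψ_lt : ∀ t : ℝ≥0, 0 < t → ψ t < t)
    (hBW : ∀ s : ℝ≥0, 0 < s → limsup ψ (nhdsWithin s (Set.Ioi s)) < s)
    (hcontr : ∀ x y, le x y → x ≠ y →
      nndist (T x) (T y) ≤ ψ (max (nndist x y) (max (nndist x (T x))
        (max (nndist y (T y)) ((nndist x (T y) + nndist (T x) y) / 2))))) :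
    ∀ x, le x (T x) →
      ∃ z, Tendsto (fun n => T^[n] x) atTop (nhds z) ∧ T z = z := by
  classical
  -- real-valued form of the contraction
  have hc : ∀ x y, le x y → x ≠ y → ∃ M : ℝ≥0, (M : ℝ) = max (dist x y) (max (dist x (T x))
        (max (dist y (T y)) ((dist x (T y) + dist (T x) y) / 2))) ∧
        dist (T x) (T y) ≤ (ψ M : ℝ) := by
    intro x y hxy hne
    refine ⟨_, ?_, NNReal.coe_le_coe.2 (hcontr x y hxy hne)⟩
    push_cast
    rfl
  have hle : ∀ t : ℝ≥0, (ψ t : ℝ) ≤ t := by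
    intro t
    rcases eq_or_ne t 0 with h | h
    · simp [h, hψ_zero]
    · exact_mod_cast (hψ_lt t (pos_iff_ne_zero.2 h)).le
  have key : ∀ s : ℝ, 0 < s → ∃ δ > 0, ∃ c < s, ∀ t : ℝ≥0, s ≤ t → (t : ℝ) < s + δ →
      (ψ t : ℝ) ≤ c := by
    intro s hs
    lift s to ℝ≥0 using hs.le
    have hs' : 0 < s := by exact_mod_cast hs
    obtain ⟨c, hc1, hc2⟩ := exists_between (hBW s hs')
    have hbd : IsBoundedUnder (· ≤ ·) (nhdsWithin s (Set.Ioi s)) ψ := by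
      refine ⟨s + 1, ?_⟩
      rw [eventually_map]
      have : ∀ᶠ t in nhdsWithin s (Set.Ioi s), t < s + 1 :=
        nhdsWithin_le_nhds (Iio_mem_nhds (by simp))
      filter_upwards [this] with t ht
      have := hle t
      exact (by exact_mod_cast this : ψ t ≤ t).trans ht.le
    have hev := eventually_lt_of_limsup_lt hc1 hbd
    rw [eventually_nhdsWithin_iff, Metric.eventually_nhds_iff] at hev
    obtain ⟨δ, hδ, hev⟩ := hev
    refine ⟨δ, hδ, max (c : ℝ) (ψ s), max_lt (by exact_mod_cast hc2)
      (by exact_mod_cast hψ_lt s hs'), ?_⟩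
    intro t h1 h2
    rcases h1.eq_or_lt with h | h
    · have : s = t := by exact_mod_cast h
      rw [this]; exact le_max_right _ _
    · refine le_max_of_le_left ?_
      have := hev (y := t) (by
        rw [NNReal.dist_eq, abs_of_pos (by linarith)]; linarith) (by exact_mod_cast h)
      exact_mod_cast this.le
  intro x0 hx0
  set x : ℕ → X := fun n => T^[n] x0 with hx
  have hxs : ∀ n, x (n + 1) = T (x n) := fun n => Function.iterate_succ_apply' T n x0
  have hasc : ∀ n, le (x n) (x (n + 1)) := by
    intro n
    induction n with
    | zero => exact hx0
    | succ n ih => rw [hxs (n + 1)]; nth_rewrite 1 [hxs n]; exact hmono _ _ ih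
  have hascm : ∀ n m, n ≤ m → le (x n) (x m) := by
    intro n m h
    induction m, h using Nat.le_induction with
    | base => exact hrefl _
    | succ m _ ih => exact htrans _ _ _ ih (hasc m)
  set D : ℕ → ℝ≥0 := fun n => nndist (x n) (x (n + 1)) with hD
  have hDd : ∀ n, (D n : ℝ) = dist (x n) (x (n + 1)) := fun n => rfl
  have hstep : ∀ n, D (n + 1) ≤ ψ (D n) := by
    intro n
    by_cases h : x n = x (n + 1)
    · have : x (n + 1) = x (n + 1 + 1) := by
        rw [hxs (n + 1)]; nth_rewrite 1 [hxs n]; rw [h]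
      simp [hD, ← this]
    · obtain ⟨M, hM, hd⟩ := hc _ _ (hasc n) h
      rw [← hxs, ← hxs, dist_self, ← hDd, ← hDd] at hM
      rw [← hxs, ← hxs, ← hDd] at hd
      have hpos : 0 < (D n : ℝ) := dist_pos.2 h
      have htri := dist_triangle (x n) (x (n + 1)) (x (n + 1 + 1))
      rw [← hDd, ← hDd] at htri
      have hM1 : (M : ℝ) = max (D n : ℝ) (D (n + 1)) := by
        rw [hM]
        apply le_antisymm
        · refine max_le (le_max_left _ _) (max_le (le_max_left _ _)
            (max_le (le_max_right _ _) ?_))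
          have := le_max_left (D n : ℝ) (D (n + 1))
          have := le_max_right (D n : ℝ) (D (n + 1))
          linarith
        · exact max_le (le_max_left _ _)
            (le_max_of_le_right (le_max_of_le_right (le_max_left _ _)))
      have hMpos : 0 < M := by
        have : 0 < (M : ℝ) := by rw [hM1]; exact lt_max_of_lt_left hpos
        exact_mod_cast this
      have hlt : (ψ M : ℝ) < M := by exact_mod_cast hψ_lt M hMpos
      rcases le_total (D (n + 1) : ℝ) (D n) with h' | h'
      · rw [max_eq_left h'] at hM1
        have : M = D n := by exact_mod_cast hM1
        rw [← this]; exact_mod_cast hd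
      · rw [max_eq_right h'] at hM1
        linarith
  have hanti : Antitone D := antitone_nat_of_succ_le fun n =>
    (hstep n).trans (by exact_mod_cast hle (D n))
  -- steps tend to zero
  have hsmall : ∀ η : ℝ, 0 < η → ∃ N, ∀ n ≥ N, dist (x n) (x (n + 1)) < η := by
    have hanti' : Antitone fun n => (D n : ℝ) := fun a b h => by exact_mod_cast hanti h
    have hbb : BddBelow (Set.range fun n => (D n : ℝ)) :=
      ⟨0, by rintro _ ⟨n, rfl⟩; exact (D n).2⟩
    have hlim := tendsto_atTop_ciInf hanti' hbb
    set s := ⨅ n, (D n : ℝ) with hs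
    have hsle : ∀ n, s ≤ D n := fun n => ciInf_le hbb n
    have hs0 : s ≤ 0 := by
      by_contra hcon
      push Not at hcon
      obtain ⟨δ, hδ, c, hcs, hk⟩ := key s hcon
      have hev : ∀ᶠ n in atTop, (D n : ℝ) < s + δ :=
        hlim.eventually (Iio_mem_nhds (by linarith))
      obtain ⟨n, hn⟩ := hev.exists
      have h1 := hk (D n) (hsle n) hn
      have h2 : (D (n + 1) : ℝ) ≤ ψ (D n) := by exact_mod_cast hstep n
      have h3 := hsle (n + 1)
      linarith
    intro η hη
    have hev : ∀ᶠ n in atTop, (D n : ℝ) < η :=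
      hlim.eventually (Iio_mem_nhds (by linarith))
    exact eventually_atTop.1 hev
  have hcau : CauchySeq x := by
    refine Metric.cauchySeq_iff'.2 ?_
    intro e he
    obtain ⟨δ, hδ, c, hce, hk⟩ := key (e / 2) (by linarith)
    obtain ⟨η, hη, hη1⟩ : ∃ η > 0, η ≤ δ / 2 ∧ η ≤ e / 2 - c ∧ η ≤ e / 2 :=
      ⟨min (δ / 2) (min (e / 2 - c) (e / 2)), by
        refine lt_min ?_ (lt_min ?_ ?_) <;> linarith,
        min_le_left _ _, (min_le_right _ _).trans (min_le_left _ _),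
        (min_le_right _ _).trans (min_le_right _ _)⟩
    obtain ⟨hη1, hη2, hη3⟩ := hη1
    obtain ⟨N, hN⟩ := hsmall η hη
    have claim : ∀ m, N ≤ m → dist (x N) (x m) < e / 2 + η := by
      intro m hm
      induction m, hm using Nat.le_induction with
      | base => rw [dist_self]; linarith
      | succ m hm ih =>
        have hn1 := hN N le_rfl
        have hm1 := hN m hm
        by_cases h : x N = x m
        · rw [hxs m, ← h, ← hxs]; linarith
        · obtain ⟨M, hM, hd⟩ := hc _ _ (hascm N m hm) h
          rw [← hxs, ← hxs] at hM hd
          have t1 := dist_triangle (x N) (x (N + 1)) (x (m + 1))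
          have t2 := dist_triangle (x N) (x m) (x (m + 1))
          have t3 := dist_triangle (x (N + 1)) (x N) (x m)
          rw [dist_comm (x (N + 1)) (x N)] at t3
          have hMlt : (M : ℝ) < e / 2 + 2 * η := by
            rw [hM]
            refine max_lt ?_ (max_lt ?_ (max_lt ?_ ?_)) <;> linarith
          rcases le_or_gt (e / 2) (M : ℝ) with h' | h'
          · have := hk M h' (by linarith)
            linarith
          · have := hle M
            linarith
    refine ⟨N, fun n hn => ?_⟩
    rw [dist_comm]
    have := claim n hn
    linarith
  obtain ⟨z, hz⟩ := hcomplete x hasc hcau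
  refine ⟨z, hz, ?_⟩
  have hz1 : Tendsto (fun n => x (n + 1)) atTop (nhds z) :=
    (tendsto_add_atTop_iff_nat 1).2 hz
  rcases hreg with hcont | hself
  · have h := hcont x z hasc hz
    simp only [← hxs] at h
    exact tendsto_nhds_unique h hz1
  · have hlez := hself x z hasc hz
    by_contra hne'
    have hb : 0 < dist z (T z) := dist_pos.2 (Ne.symm hne')
    have e1 : ∀ᶠ n in atTop, dist (x n) z < dist z (T z) / 4 :=
      hz.eventually (Metric.ball_mem_nhds z (by linarith))
    have e2 : ∀ᶠ n in atTop, dist (x (n + 1)) z < dist z (T z) / 4 :=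
      hz1.eventually (Metric.ball_mem_nhds z (by linarith))
    have hev : ∀ᶠ n in atTop, dist (x (n + 1)) (T z) ≤ ψ (nndist z (T z)) := by
      filter_upwards [e1, e2] with n h1 h2
      by_cases h : x n = z
      · rw [hxs, h, dist_self]; exact (ψ _).2
      · obtain ⟨M, hM, hd⟩ := hc _ _ (hlez n) h
        rw [← hxs] at hM hd
        have t1 := dist_triangle_right (x n) (x (n + 1)) z
        have t2 := dist_triangle (x n) z (T z)
        have hMe : (M : ℝ) = dist z (T z) := by
          rw [hM]
          apply le_antisymm
          · refine max_le ?_ (max_le ?_ (max_le le_rfl ?_)) <;> linarith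
          · exact le_max_of_le_right (le_max_of_le_right (le_max_left _ _))
        have : M = nndist z (T z) := NNReal.coe_injective hMe
        rw [← this]; exact hd
    have hl : Tendsto (fun n => dist (x (n + 1)) (T z)) atTop (nhds (dist z (T z))) :=
      hz1.dist tendsto_const_nhds
    have h1 := le_of_tendsto hl hev
    have h2 : (ψ (nndist z (T z)) : ℝ) < dist z (T z) :=
      NNReal.coe_lt_coe.2 (hψ_lt (nndist z (T z)) (by exact_mod_cast hb))
    linarith
end

section
/- Let ψ : [0,∞) → [0,∞) be regressive (ψ(0) = 0, ψ(t) < t for t > 0) and Boyd–Wong admissible (limsup_{t→s+} ψ(t) < s for every s > 0), and let F : [0,∞)^6 → ℝ be ψ-compatible: for all u, v ∈ [0,∞), F(u, v, v, u, u+v, 0) ≤ 0 implies u ≤ ψ(v). Then F is almost-compatible: for every sequence (r_n) in (0,∞) with F(r_n, r_{n−1}, r_{n−1}, r_n, r_n + r_{n−1}, 0) ≤ 0 for all n ≥ 1, one has r_n → 0. -/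
open Filter Topology
open scoped NNReal

/-- **Section 5.**
Let `ψ : [0,∞) → [0,∞)` be regressive (`ψ 0 = 0`, `ψ t < t` for `t > 0`) and Boyd–Wong
admissible (`limsup_{t → s+} ψ t < s` for every `s > 0`), and let `F : [0,∞)^6 → ℝ` be
`ψ`-compatible: `F u v v u (u+v) 0 ≤ 0` implies `u ≤ ψ v`.  Then `F` is
almost-compatible: every sequence `(r n)` in `(0,∞)` with
`F (r (n+1)) (r n) (r n) (r (n+1)) (r (n+1) + r n) 0 ≤ 0` for all `n` tends to `0`. -/
theorem almost_compatible_of_psi_compatible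
    (ψ : ℝ≥0 → ℝ≥0)
    (hψ_zero : ψ 0 = 0)
    (hψ_lt : ∀ t : ℝ≥0, 0 < t → ψ t < t)
    (hBW : ∀ s : ℝ≥0, 0 < s → limsup ψ (nhdsWithin s (Set.Ioi s)) < s)
    (F : ℝ≥0 → ℝ≥0 → ℝ≥0 → ℝ≥0 → ℝ≥0 → ℝ≥0 → ℝ)
    (hψF : ∀ u v : ℝ≥0, F u v v u (u + v) 0 ≤ 0 → u ≤ ψ v) :
    ∀ r : ℕ → ℝ≥0, (∀ n, 0 < r n) →
      (∀ n, F (r (n + 1)) (r n) (r n) (r (n + 1)) (r (n + 1) + r n) 0 ≤ 0) →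
      Tendsto r atTop (nhds 0) := by
  intro r hr hF
  have h1 : ∀ n, r (n + 1) ≤ ψ (r n) := fun n => hψF _ _ (hF n)
  have hlt : ∀ n, r (n + 1) < r n := fun n => (h1 n).trans_lt (hψ_lt _ (hr n))
  have hanti : StrictAnti r := strictAnti_nat_of_succ_lt hlt
  have hbdd : BddBelow (Set.range r) := OrderBot.bddBelow _
  have hlim : Tendsto r atTop (𝓝 (⨅ n, r n)) := tendsto_atTop_ciInf hanti.antitone hbdd
  have hle : ∀ n, (⨅ n, r n) ≤ r n := fun n => ciInf_le hbdd n
  generalize (⨅ n, r n) = L at hlim hle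
  rcases eq_or_ne L 0 with h0 | h0
  · rwa [h0] at hlim
  exfalso
  have hL : 0 < L := pos_iff_ne_zero.mpr h0
  have hb : IsBoundedUnder (· ≤ ·) (𝓝[>] L) ψ := by
    refine isBoundedUnder_of_eventually_le (a := L + 1) ?_
    have h2 : ∀ᶠ t in 𝓝[>] L, t < L + 1 :=
      nhdsWithin_le_nhds (Iio_mem_nhds (lt_add_of_pos_right L one_pos))
    filter_upwards [h2, self_mem_nhdsWithin] with t ht ht'
    exact ((hψ_lt t (hL.trans ht')).trans ht).le
  have hev : ∀ᶠ t in 𝓝[>] L, ψ t < L := eventually_lt_of_limsup_lt (hBW L hL) hb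
  have hlim' : Tendsto r atTop (𝓝[>] L) :=
    tendsto_nhdsWithin_iff.mpr
      ⟨hlim, Eventually.of_forall fun n => (hle (n + 1)).trans_lt (hlt n)⟩
  obtain ⟨n, hn⟩ := (hlim'.eventually hev).exists
  exact absurd ((hle (n + 1)).trans (h1 n)) (not_le.mpr hn)
end

section
/- Let S be a nonempty set and P a nonempty proper subset of S. Let F : [0,∞)^6 → S satisfy: (f01) F(w,w,0,0,w,w) ∉ P for all w > 0; (f02) if u,v > 0, p ≤ u+v and F(u,v,v,u,p,0) ∈ P, then u ≤ v; and for each r > 0 there exists a(r) ∈ (0,r) such that: (f03) if u,v ∈ [r, r+a(r)), u ≤ v, p ≤ u+v, then F(u,v,v,u,p,0) ∉ P; (f04) if t,p,q ∈ (r−a(r), r+a(r)), u ∈ [r, r+a(r)), v,w ∈ (0, a(r)), then F(t,u,v,w,p,q) ∉ P; (f05) if t,p ∈ (r−a(r), r+a(r)), u,v,q ∈ (0, a(r)), then F(t,u,v,r,p,q) ∉ P. Let (X,d) be a complete metric space and T : X → X a selfmap such that F(d(Tx,Ty), d(x,y), d(x,Tx), d(y,Ty), d(x,Ty), d(y,Tx))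 ∈ P for all x,y ∈ X with Tx ≠ Ty. Then T has a unique fixed point z ∈ X, and T^n x → z as n → ∞ for every x ∈ X. -/
open Filter Topology
open scoped NNReal

/-- **Theorem 6.1 (Turinici 1976).**
Let `S` be a nonempty set, `P` a nonempty proper subset of `S`, and `F : [0,∞)^6 → S`
satisfying (f01) `F w w 0 0 w w ∉ P` for `w > 0`; (f02) `u, v > 0`, `p ≤ u + v` and
`F u v v u p 0 ∈ P` imply `u ≤ v`; and for each `r > 0` there is `a ∈ (0, r)` with
(f03) `u, v ∈ [r, r+a)`, `u ≤ v`, `p ≤ u + v` imply `F u v v u p 0 ∉ P`;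
(f04) `t, p, q ∈ (r-a, r+a)`, `u ∈ [r, r+a)`, `v, w ∈ (0, a)` imply `F t u v w p q ∉ P`;
(f05) `t, p ∈ (r-a, r+a)`, `u, v, q ∈ (0, a)` imply `F t u v r p q ∉ P`.
If `(X, d)` is a complete metric space and `T : X → X` satisfies
`F (d (T x) (T y)) (d x y) (d x (T x)) (d y (T y)) (d x (T y)) (d y (T x)) ∈ P`
whenever `T x ≠ T y`, then `T` has a unique fixed point `z`, and `T^[n] x → z`
for every `x ∈ X`. -/
theorem fixed_point_of_six_implicit_contraction
    {S : Type*} (P : Set S) (hPne : P.Nonempty) (hPproper : P ≠ Set.univ)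
    (F : ℝ≥0 → ℝ≥0 → ℝ≥0 → ℝ≥0 → ℝ≥0 → ℝ≥0 → S)
    (f01 : ∀ w : ℝ≥0, 0 < w → F w w 0 0 w w ∉ P)
    (f02 : ∀ u v p : ℝ≥0, 0 < u → 0 < v → p ≤ u + v → F u v v u p 0 ∈ P → u ≤ v)
    (floc : ∀ r : ℝ≥0, 0 < r → ∃ a : ℝ≥0, 0 < a ∧ a < r ∧
      (∀ u v p : ℝ≥0, r ≤ u → u < r + a → r ≤ v → v < r + a → u ≤ v → p ≤ u + v →
        F u v v u p 0 ∉ P) ∧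
      (∀ t u v w p q : ℝ≥0,
        r - a < t → t < r + a → r - a < p → p < r + a → r - a < q → q < r + a →
        r ≤ u → u < r + a → 0 < v → v < a → 0 < w → w < a →
        F t u v w p q ∉ P) ∧
      (∀ t u v p q : ℝ≥0,
        r - a < t → t < r + a → r - a < p → p < r + a →
        0 < u → u < a → 0 < v → v < a → 0 < q → q < a →
        F t u v r p q ∉ P))
    {X : Type*} [MetricSpace X] [CompleteSpace X] [Nonempty X]
    (T : X → X)
    (hcontr : ∀ x y : X, T x ≠ T y →
      F (nndist (T x) (T y)) (nndist x y) (nndist x (T x)) (nndist y (T y))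
        (nndist x (T y)) (nndist y (T x)) ∈ P) :
    ∃ z : X, T z = z ∧ (∀ w : X, T w = w → w = z) ∧
      ∀ x : X, Tendsto (fun n => T^[n] x) atTop (nhds z) := by
  have key : ∀ x : X, ∃ z : X, T z = z ∧ Tendsto (fun n => T^[n] x) atTop (nhds z) := by
    intro x
    set s : ℕ → X := fun n => T^[n] x with hs
    have hstep : ∀ n, T (s n) = s (n + 1) := by
      intro n
      simp only [hs, Function.iterate_succ_apply']
    by_cases hfix : ∃ n, s (n + 1) = s n
    · obtain ⟨n, hn⟩ := hfix
      have hTn : T (s n) = s n := by rw [hstep, hn]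
      refine ⟨s n, hTn, ?_⟩
      have hconst : ∀ k, s (n + k) = s n := by
        intro k
        induction k with
        | zero => rfl
        | succ k ih => rw [← add_assoc, ← hstep, ih, hTn]
      refine tendsto_const_nhds.congr' ?_
      filter_upwards [eventually_ge_atTop n] with m hm
      obtain ⟨k, rfl⟩ := Nat.exists_eq_add_of_le hm
      exact (hconst k).symm
    push Not at hfix
    set δ : ℕ → ℝ≥0 := fun n => nndist (s n) (s (n + 1)) with hδ
    have hpos : ∀ n, 0 < δ n := by
      intro n
      rw [pos_iff_ne_zero]
      intro h
      exact hfix n (nndist_eq_zero.mp h).symm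
    have hF : ∀ n, F (δ (n + 1)) (δ n) (δ n) (δ (n + 1)) (nndist (s n) (s (n + 2))) 0 ∈ P := by
      intro n
      have h := hcontr (s n) (s (n + 1))
        (by rw [hstep, hstep]; exact (hfix (n + 1)).symm)
      rw [hstep, hstep, nndist_self] at h
      exact h
    have htri : ∀ n, nndist (s n) (s (n + 2)) ≤ δ (n + 1) + δ n := by
      intro n
      rw [add_comm (δ (n + 1))]
      exact nndist_triangle (s n) (s (n + 1)) (s (n + 2))
    have hle : ∀ n, δ (n + 1) ≤ δ n := fun n =>
      f02 _ _ _ (hpos _) (hpos _) (htri n) (hF n)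
    have hanti : Antitone δ := antitone_nat_of_succ_le hle
    have hlim : Tendsto δ atTop (𝓝 0) := by
      have h1 : Tendsto δ atTop (𝓝 (⨅ i, δ i)) :=
        tendsto_atTop_ciInf hanti (OrderBot.bddBelow _)
      have hlb : ∀ n, (⨅ i, δ i) ≤ δ n := fun n => ciInf_le (OrderBot.bddBelow _) n
      generalize (⨅ i, δ i) = r at h1 hlb
      rcases eq_or_ne r 0 with h0 | h0
      · rwa [h0] at h1
      exfalso
      obtain ⟨a, ha, -, h3, -⟩ := floc r (pos_iff_ne_zero.mpr h0)
      obtain ⟨n, hn⟩ := (h1.eventually_lt_const (lt_add_of_pos_right r ha)).exists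
      exact h3 _ _ _ (hlb _) ((hle n).trans_lt hn) (hlb n) hn (hle n) (htri n) (hF n)
    have hcauchy : CauchySeq s := by
      rw [Metric.cauchySeq_iff']
      by_contra hcon
      push Not at hcon
      obtain ⟨ε, hε, hN⟩ := hcon
      lift ε to ℝ≥0 using hε.le
      have hε' : 0 < ε := by exact_mod_cast hε
      obtain ⟨a, ha, har, -, h4, -⟩ := floc ε hε'
      have ha3 : 0 < a / 3 := by positivity
      obtain ⟨N, hNd⟩ := eventually_atTop.mp (hlim.eventually_lt_const ha3)
      have hex := hN N
      classical
      let n := Nat.find hex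
      obtain ⟨hn1, hn2⟩ : n ≥ N ∧ (ε : ℝ) ≤ dist (s n) (s N) := Nat.find_spec hex
      have hne : n ≠ N := by
        intro h
        rw [h, dist_self] at hn2
        linarith
      have hmin : ∀ k, k < n → N ≤ k → dist (s k) (s N) < ε := by
        intro k hk hNk
        by_contra hc
        exact Nat.find_min hex hk ⟨hNk, not_lt.mp hc⟩
      generalize n = n at hn1 hn2 hne hmin
      obtain ⟨k, rfl⟩ : ∃ k, n = k + 1 := ⟨n - 1, by omega⟩
      have hNk : N ≤ k := by omega
      have hk := hmin k (by omega) hNk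
      have hd : ∀ j, N ≤ j → dist (s j) (s (j + 1)) < a / 3 := by
        intro j hj
        have := hNd j hj
        have h2 : ((δ j : ℝ≥0) : ℝ) < ((a / 3 : ℝ≥0) : ℝ) := by exact_mod_cast this
        simpa [hδ] using h2
      have hdN := hd N le_rfl
      have hdk := hd k hNk
      have hdk1 := hd (k + 1) (by omega)
      have harR : (a : ℝ) < ε := by exact_mod_cast har
      have haR : (0 : ℝ) < a := by exact_mod_cast ha
      have e1 : dist (s N) (s (k + 1)) = dist (s (k + 1)) (s N) := dist_comm _ _
      have e2 : dist (s (k + 1)) (s k) = dist (s k) (s (k + 1)) := dist_comm _ _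
      have e3 : dist (s (k + 2)) (s (k + 1)) = dist (s (k + 1)) (s (k + 2)) := dist_comm _ _
      have e4 : dist (s (N + 1)) (s N) = dist (s N) (s (N + 1)) := dist_comm _ _
      have e5 : dist (s (N + 1)) (s (k + 1)) = dist (s (k + 1)) (s (N + 1)) := dist_comm _ _
      have u1 := dist_triangle (s (k + 1)) (s k) (s N)
      have p1 := dist_triangle (s N) (s (k + 1)) (s (k + 2))
      have p2 := dist_triangle (s N) (s (k + 2)) (s (k + 1))
      have q1 := dist_triangle (s (k + 1)) (s N) (s (N + 1))
      have q2 := dist_triangle (s (k + 1)) (s (N + 1)) (s N)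
      have t1 := dist_triangle (s (N + 1)) (s (k + 1)) (s (k + 2))
      have t2 := dist_triangle (s (N + 1)) (s (k + 2)) (s (k + 1))
      have hk12 : dist (s (k + 1)) (s (k + 1 + 1)) = dist (s (k + 1)) (s (k + 2)) := rfl
      have hT : T (s N) ≠ T (s (k + 1)) := by
        rw [hstep, hstep]
        intro h
        have : dist (s (N + 1)) (s (k + 2)) = 0 := dist_eq_zero.mpr h
        linarith
      have hmem := hcontr (s N) (s (k + 1)) hT
      rw [hstep, hstep] at hmem
      refine h4 _ _ _ _ _ _ ?_ ?_ ?_ ?_ ?_ ?_ ?_ ?_ (hpos N) ?_ (hpos (k + 1)) ?_ hmem <;>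
        simp only [← NNReal.coe_lt_coe, ← NNReal.coe_le_coe, NNReal.coe_sub har.le,
          NNReal.coe_add, coe_nndist, hδ] <;>
        linarith
    obtain ⟨z, hz⟩ := cauchySeq_tendsto_of_complete hcauchy
    refine ⟨z, ?_, hz⟩
    by_contra hTz
    have hr : 0 < nndist z (T z) := by
      rw [pos_iff_ne_zero]
      intro h
      exact hTz (nndist_eq_zero.mp h).symm
    obtain ⟨a, ha, har, -, -, h5⟩ := floc _ hr
    have hz' : Tendsto (fun n => s (n + 1)) atTop (𝓝 z) := (tendsto_add_atTop_iff_nat 1).mpr hz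
    have lt1 : Tendsto (fun n => nndist (s (n + 1)) (T z)) atTop (𝓝 (nndist z (T z))) :=
      hz'.nndist tendsto_const_nhds
    have lp : Tendsto (fun n => nndist (s n) (T z)) atTop (𝓝 (nndist z (T z))) :=
      hz.nndist tendsto_const_nhds
    have lu : Tendsto (fun n => nndist (s n) z) atTop (𝓝 0) := by
      simpa using hz.nndist (tendsto_const_nhds (x := z))
    have lq : Tendsto (fun n => nndist z (s (n + 1))) atTop (𝓝 0) := by
      simpa using (tendsto_const_nhds (x := z)).nndist hz'
    have hsub : nndist z (T z) - a < nndist z (T z) := tsub_lt_self hr ha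
    have hadd : nndist z (T z) < nndist z (T z) + a := lt_add_of_pos_right _ ha
    obtain ⟨n, g1, g2, g3, g4, g5, g6, g7, g8⟩ :=
      ((lt1.eventually_const_lt hsub).and <| (lt1.eventually_lt_const hadd).and <|
        (lp.eventually_const_lt hsub).and <| (lp.eventually_lt_const hadd).and <|
        (lu.eventually_lt_const ha).and <| (lq.eventually_lt_const ha).and <|
        (hlim.eventually_lt_const ha).and (hlim.eventually_lt_const hr)).exists
    have hnz : ∀ m, n ≤ m → s m ≠ z := by
      intro m hm h
      have h1 : δ m < nndist z (T z) := (hanti hm).trans_lt g8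
      have h2 : δ m = nndist z (T z) := by
        simp only [hδ]
        rw [← hstep, h]
      exact h1.ne h2
    have hT : T (s n) ≠ T z := by
      rw [hstep]
      intro h
      rw [h, nndist_self] at g1
      exact not_lt_zero g1
    have hmem := hcontr (s n) z hT
    rw [hstep] at hmem
    exact h5 _ _ _ _ _ g1 g2 g3 g4
      (pos_iff_ne_zero.mpr fun h => hnz n le_rfl (nndist_eq_zero.mp h)) g5
      (hpos n) g7
      (pos_iff_ne_zero.mpr fun h => hnz (n + 1) (Nat.le_succ n) (nndist_eq_zero.mp h).symm) g6
      hmem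
  have huniq : ∀ z w : X, T z = z → T w = w → w = z := by
    intro z w hz hw
    by_contra hne
    have hmem := hcontr w z (by rwa [hz, hw])
    rw [hz, hw, nndist_self, nndist_self, nndist_comm z w] at hmem
    exact f01 _ (pos_iff_ne_zero.mpr fun h => hne (nndist_eq_zero.mp h)) hmem
  obtain ⟨x₀⟩ := ‹Nonempty X›
  obtain ⟨z, hz, -⟩ := key x₀
  refine ⟨z, hz, fun w hw => huniq z w hz hw, fun x => ?_⟩
  obtain ⟨z', hz', hlim⟩ := key x
  rwa [huniq z z' hz hz'] at hlim
end

section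
/- Let (X,d,≤) be a quasi-ordered metric space, let T : X → X be ≤-increasing, let F : [0,∞)^6 → ℝ be compatible, and assume T is (d,≤;M;F)-contractive, i.e. F(d(Tx,Ty), d(x,y), d(x,Tx), d(y,Ty), d(x,Ty), d(Tx,y)) ≤ 0 for all x,y ∈ X with x ≤ y and x ≠ y. If x_0 ∈ X satisfies x_0 ≤ Tx_0 and T^n x_0 ≠ T^{n+1} x_0 for all n ≥ 0, then d(T^n x_0, T^{n+1} x_0) → 0 as n → ∞ (so the orbit (T^n x_0) is d-semi-Cauchy). -/
open Filter Topology
open scoped NNReal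

/-- **Step 1 of the proof of the main result.**
Let `(X, d, le)` be a quasi-ordered metric space, `T` a `le`-increasing selfmap, and
`F : [0,∞)^6 → ℝ` a compatible function with `T` `(d, le; M; F)`-contractive.  If
`le x₀ (T x₀)` and `T^[n] x₀ ≠ T^[n+1] x₀` for all `n`, then
`d (T^[n] x₀) (T^[n+1] x₀) → 0`, i.e. the orbit of `x₀` is `d`-semi-Cauchy. -/
theorem orbit_semiCauchy_of_implicit_contraction
    {X : Type*} [MetricSpace X]
    (le : X → X → Prop)
    (hrefl : ∀ x, le x x)
    (htrans : ∀ x y z, le x y → le y z → le x z)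
    (T : X → X)
    (hmono : ∀ x y, le x y → le (T x) (T y))
    (F : ℝ≥0 → ℝ≥0 → ℝ≥0 → ℝ≥0 → ℝ≥0 → ℝ≥0 → ℝ)
    (hFcomp : FCompatible F)
    (hcontr : ∀ x y, le x y → x ≠ y →
      F (nndist (T x) (T y)) (nndist x y) (nndist x (T x)) (nndist y (T y))
        (nndist x (T y)) (nndist (T x) y) ≤ 0)
    (x₀ : X) (hx₀ : le x₀ (T x₀))
    (hdistinct : ∀ n : ℕ, T^[n] x₀ ≠ T^[n + 1] x₀) :
    Tendsto (fun n => nndist (T^[n] x₀) (T^[n + 1] x₀)) atTop (nhds 0) := by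
  have hle : ∀ n : ℕ, le (T^[n] x₀) (T^[n + 1] x₀) := by
    intro n
    induction n with
    | zero => exact hx₀
    | succ k ih =>
      rw [Function.iterate_succ_apply' T (k + 1), Function.iterate_succ_apply' T k]
      rw [Function.iterate_succ_apply' T k] at ih
      exact hmono _ _ ih
  refine hFcomp _ (fun n => nndist (T^[n] x₀) (T^[n + 2] x₀)) ?_ ?_ ?_
  · intro n
    exact pos_iff_ne_zero.mpr (fun h => hdistinct n (nndist_eq_zero.mp h))
  · intro n
    have h := hcontr _ _ (hle n) (hdistinct n)
    simp only [← Function.iterate_succ_apply' T, nndist_self] at h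
    exact h
  · intro n
    simp only [coe_nndist]
    have h1 := dist_triangle (T^[n] x₀) (T^[n + 1] x₀) (T^[n + 2] x₀)
    have h2 := dist_triangle_right (T^[n] x₀) (T^[n + 1] x₀) (T^[n + 2] x₀)
    rw [abs_le]
    constructor <;> linarith
end
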